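/- arXiv:math/0002122 — 9 statements merged into one kernel-verified Lean document; each statement's English description precedes it below -/
import Mathlib

section
/- Let m ≥ 1, let S = [[A, B], [C, D]] be an element of Sp(2m, ℝ) written in m×m blocks, and let 𝒩 be a symmetric complex m×m matrix whose imaginary part Im 𝒩 is negative definite. Then the matrix A + B𝒩 is invertible. -/
open Matrix
open scoped ComplexOrder

/-- The imaginary part `Im 𝒩 := (𝒩 − conj 𝒩)/(2i)` of a complex matrix. -/
noncomputable def matImagPart {m : ℕ} (N : Matrix (Fin m) (Fin m) ℂ) :
    Matrix (Fin m) (Fin m) ℂ :=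
  ((2 : ℂ) * Complex.I)⁻¹ • (N - N.map (starRingEnd ℂ))

/-- For symplectic `[[A, B], [C, D]]`, the graph of `N` is mapped to the pair `(A + B N, C + D N)`
with the same Hermitian symplectic form, namely `N - Nᴴ`. -/
lemma conjTranspose_mul_sub_of_symplectic {n : Type*} [Fintype n] [DecidableEq n]
    (A B C D : Matrix n n ℝ)
    (hS : (Matrix.fromBlocks A B C D)ᵀ *
        (Matrix.fromBlocks 0 1 (-1) 0 : Matrix (n ⊕ n) (n ⊕ n) ℝ) *
        Matrix.fromBlocks A B C D =
        (Matrix.fromBlocks 0 1 (-1) 0 : Matrix (n ⊕ n) (n ⊕ n) ℝ))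
    (N : Matrix n n ℂ) :
    (A.map Complex.ofReal + B.map Complex.ofReal * N)ᴴ *
        (C.map Complex.ofReal + D.map Complex.ofReal * N) -
      (C.map Complex.ofReal + D.map Complex.ofReal * N)ᴴ *
        (A.map Complex.ofReal + B.map Complex.ofReal * N) = N - Nᴴ := by
  have star_map (M : Matrix n n ℝ) : (M.map Complex.ofReal)ᴴ = Mᵀ.map Complex.ofReal := by
    ext i j
    simp
  have map_mul (M M' : Matrix n n ℝ) : (M * M').map Complex.ofReal =
      M.map Complex.ofReal * M'.map Complex.ofReal :=
    Matrix.map_mul (f := Complex.ofRealHom)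
  simp only [fromBlocks_transpose, fromBlocks_multiply, fromBlocks_inj, mul_zero, mul_one,
    zero_add, add_zero, mul_neg, neg_mul] at hS
  obtain ⟨h₁, h₂, h₃, h₄⟩ := hS
  have map_eq {X X' Y Y' Z : Matrix n n ℝ} (h : -(X * X') + Y * Y' = Z) :
      Y.map Complex.ofReal * Y'.map Complex.ofReal =
        X.map Complex.ofReal * X'.map Complex.ofReal + Z.map Complex.ofReal := by
    rw [← map_mul, ← map_mul, ← Matrix.map_add _ Complex.ofReal_add, ← h, add_neg_cancel_left]
  have e₁ := map_eq h₁
  have e₂ := map_eq h₂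
  have e₃ := map_eq h₃
  have e₄ := map_eq h₄
  have map_one : (1 : Matrix n n ℝ).map Complex.ofReal = 1 := by simp
  have map_neg_one : (-1 : Matrix n n ℝ).map Complex.ofReal = -1 := by
    ext i j
    by_cases h : i = j <;> simp [h]
  have map_zero : (0 : Matrix n n ℝ).map Complex.ofReal = 0 := by simp
  rw [map_zero, add_zero] at e₁ e₄
  rw [map_one] at e₂
  rw [map_neg_one] at e₃
  simp only [conjTranspose_add, conjTranspose_mul, star_map, add_mul, mul_add, mul_assoc, e₁, e₃]
  simp only [← mul_assoc, e₂]
  simp only [mul_assoc Nᴴ, e₄]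
  noncomm_ring

/-- If `S = [[A,B],[C,D]] ∈ Sp(2m,ℝ)` and `𝒩` is a symmetric complex
`m×m` matrix with `Im 𝒩` negative definite, then `A + B𝒩` is invertible. -/
theorem isUnit_A_add_B_mul_of_imagPart_negDef (m : ℕ) (hm : 1 ≤ m)
    (A B C D : Matrix (Fin m) (Fin m) ℝ)
    (hS : (Matrix.fromBlocks A B C D)ᵀ *
        (Matrix.fromBlocks 0 1 (-1) 0 : Matrix (Fin m ⊕ Fin m) (Fin m ⊕ Fin m) ℝ) *
        Matrix.fromBlocks A B C D =
        (Matrix.fromBlocks 0 1 (-1) 0 : Matrix (Fin m ⊕ Fin m) (Fin m ⊕ Fin m) ℝ))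
    (N : Matrix (Fin m) (Fin m) ℂ) (hNsym : N.IsSymm)
    (hNneg : (-(matImagPart N)).PosDef) :
    IsUnit (A.map Complex.ofReal + B.map Complex.ofReal * N) := by
  have key := conjTranspose_mul_sub_of_symplectic A B C D hS N
  set P := A.map Complex.ofReal + B.map Complex.ofReal * N
  set K := C.map Complex.ofReal + D.map Complex.ofReal * N
  have hconj : N.map (starRingEnd ℂ) = Nᴴ := by
    rw [conjTranspose, hNsym.eq]
    rfl
  rw [← Matrix.mulVec_injective_iff_isUnit, ← Matrix.coe_mulVecLin, injective_iff_map_eq_zero]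
  intro x hx
  rw [mulVecLin_apply] at hx
  by_contra hx0
  have hform : star x ⬝ᵥ ((N - Nᴴ) *ᵥ x) = 0 := by
    rw [← key, sub_mulVec, ← mulVec_mulVec, ← mulVec_mulVec, hx, dotProduct_sub,
      dotProduct_mulVec, ← star_mulVec, hx]
    simp
  have hpos := hNneg.dotProduct_mulVec_pos hx0
  rw [matImagPart, hconj, neg_mulVec, smul_mulVec, dotProduct_neg, dotProduct_smul, hform] at hpos
  simp at hpos
end

section
/- Let m ≥ 1, let S = [[A, B], [C, D]] be an element of Sp(2m, ℝ) written in m×m blocks, and let 𝒩 be a symmetric complex m×m matrix such that P := A + B𝒩 is invertible. Then the imaginary part of the transformed matrix 𝒩̃ := (C + D𝒩)P⁻¹ satisfies Im 𝒩̃ = (P⁻¹)† (Im 𝒩) P⁻¹, where † denotes conjugate transpose. -/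
open Matrix

/-- The block identity expressing that `S = [[a, b], [c, d]]` preserves the symplectic form,
evaluated on the column blocks `[1; M]` and `[1; N]`. -/
theorem transpose_mul_sub_transpose_mul_of_symplectic {n R : Type*} [Fintype n] [DecidableEq n]
    [CommRing R] {a b c d : Matrix n n R} (hac : aᵀ * c - cᵀ * a = 0) (had : aᵀ * d - cᵀ * b = 1)
    (hbc : bᵀ * c - dᵀ * a = -1) (hbd : bᵀ * d - dᵀ * b = 0) (M N : Matrix n n R) :
    (a + b * M)ᵀ * (c + d * N) - (c + d * M)ᵀ * (a + b * N) = N - Mᵀ := by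
  have h : (a + b * M)ᵀ * (c + d * N) - (c + d * M)ᵀ * (a + b * N) =
      (aᵀ * c - cᵀ * a) + (aᵀ * d - cᵀ * b) * N + Mᵀ * (bᵀ * c - dᵀ * a) +
        Mᵀ * (bᵀ * d - dᵀ * b) * N := by
    simp only [transpose_add, transpose_mul]
    noncomm_ring
  rw [h, hac, had, hbc, hbd]
  noncomm_ring

/-- The block identities satisfied by a matrix preserving the standard symplectic form. -/
theorem symplectic_block_identities {n R : Type*} [Fintype n] [DecidableEq n] [CommRing R]
    {A B C D : Matrix n n R}
    (hS : (fromBlocks A B C D)ᵀ * (fromBlocks 0 1 (-1) 0 : Matrix (n ⊕ n) (n ⊕ n) R) *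
      fromBlocks A B C D = fromBlocks 0 1 (-1) 0) :
    Aᵀ * C - Cᵀ * A = 0 ∧ Aᵀ * D - Cᵀ * B = 1 ∧ Bᵀ * C - Dᵀ * A = -1 ∧
      Bᵀ * D - Dᵀ * B = 0 := by
  rw [fromBlocks_transpose, fromBlocks_multiply, fromBlocks_multiply, fromBlocks_inj] at hS
  simpa [sub_eq_add_neg, add_comm] using hS

/-- Entrywise complexification preserves the property of preserving the symplectic form. -/
theorem symplectic_map_ofReal {n : Type*} [Fintype n] [DecidableEq n] {A B C D : Matrix n n ℝ}
    (hS : (fromBlocks A B C D)ᵀ * (fromBlocks 0 1 (-1) 0 : Matrix (n ⊕ n) (n ⊕ n) ℝ) *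
      fromBlocks A B C D = fromBlocks 0 1 (-1) 0) :
    (fromBlocks (A.map Complex.ofReal) (B.map Complex.ofReal) (C.map Complex.ofReal)
        (D.map Complex.ofReal))ᵀ * (fromBlocks 0 1 (-1) 0 : Matrix (n ⊕ n) (n ⊕ n) ℂ) *
      fromBlocks (A.map Complex.ofReal) (B.map Complex.ofReal) (C.map Complex.ofReal)
        (D.map Complex.ofReal) = fromBlocks 0 1 (-1) 0 := by
  have hΩ : (fromBlocks 0 1 (-1) 0 : Matrix (n ⊕ n) (n ⊕ n) ℝ).map Complex.ofRealHom =
      fromBlocks 0 1 (-1) 0 := by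
    simp [fromBlocks_map, Matrix.map_neg]
  have h := congrArg (fun X => X.map Complex.ofRealHom) hS
  simp only [Matrix.map_mul, transpose_map, hΩ] at h
  rw [fromBlocks_map] at h
  exact h

/-- If `S = [[A,B],[C,D]] ∈ Sp(2m,ℝ)` and `𝒩` is a symmetric complex
`m×m` matrix with `P := A + B𝒩` invertible, then the transformed matrix
`𝒩̃ := (C + D𝒩)P⁻¹` satisfies `Im 𝒩̃ = (P⁻¹)ᴴ (Im 𝒩) P⁻¹`. -/
theorem imagPart_symplectic_transform (m : ℕ) (hm : 1 ≤ m)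
    (A B C D : Matrix (Fin m) (Fin m) ℝ)
    (hS : (Matrix.fromBlocks A B C D)ᵀ *
        (Matrix.fromBlocks 0 1 (-1) 0 : Matrix (Fin m ⊕ Fin m) (Fin m ⊕ Fin m) ℝ) *
        Matrix.fromBlocks A B C D =
        (Matrix.fromBlocks 0 1 (-1) 0 : Matrix (Fin m ⊕ Fin m) (Fin m ⊕ Fin m) ℝ))
    (N : Matrix (Fin m) (Fin m) ℂ) (hNsym : N.IsSymm)
    (hP : IsUnit (A.map Complex.ofReal + B.map Complex.ofReal * N)) :
    matImagPart ((C.map Complex.ofReal + D.map Complex.ofReal * N) *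
        (A.map Complex.ofReal + B.map Complex.ofReal * N)⁻¹) =
      ((A.map Complex.ofReal + B.map Complex.ofReal * N)⁻¹)ᴴ *
        matImagPart N * (A.map Complex.ofReal + B.map Complex.ofReal * N)⁻¹ := by
  obtain ⟨hac, had, hbc, hbd⟩ := symplectic_block_identities (symplectic_map_ofReal hS)
  have key := transpose_mul_sub_transpose_mul_of_symplectic hac had hbc hbd
  have conjTranspose_affine (X Y : Matrix (Fin m) (Fin m) ℝ) :
      (X.map Complex.ofReal + Y.map Complex.ofReal * N)ᴴ =
        (X.map Complex.ofReal + Y.map Complex.ofReal * N.map (starRingEnd ℂ))ᵀ := by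
    have hX (Z : Matrix (Fin m) (Fin m) ℝ) :
        (Z.map Complex.ofReal)ᴴ = (Z.map Complex.ofReal)ᵀ := by
      ext i j
      simp
    simp only [conjTranspose_add, conjTranspose_mul, transpose_add, transpose_mul, hX]
    rfl
  have hsymm := key N N
  have hherm := key (N.map (starRingEnd ℂ)) N
  rw [← conjTranspose_affine, ← conjTranspose_affine, ← transpose_map, hNsym.eq] at hherm
  rw [hNsym.eq, sub_self, sub_eq_zero] at hsymm
  set P := A.map Complex.ofReal + B.map Complex.ofReal * N
  set Q := C.map Complex.ofReal + D.map Complex.ofReal * N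
  have hdet : IsUnit P.det := (isUnit_iff_isUnit_det P).1 hP
  have hPinv : P * P⁻¹ = 1 := mul_nonsing_inv P hdet
  have hPinvT : P⁻¹ᵀ * Pᵀ = 1 := by rw [← transpose_mul, hPinv, transpose_one]
  have hPinvH : P⁻¹ᴴ * Pᴴ = 1 := by rw [← conjTranspose_mul, hPinv, conjTranspose_one]
  have hQsymm : (Q * P⁻¹)ᵀ = Q * P⁻¹ := by
    calc (Q * P⁻¹)ᵀ = P⁻¹ᵀ * (Qᵀ * P) * P⁻¹ := by
          rw [transpose_mul, Matrix.mul_assoc, Matrix.mul_assoc, hPinv, Matrix.mul_one]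
      _ = Q * P⁻¹ := by rw [← hsymm, ← Matrix.mul_assoc, hPinvT, Matrix.one_mul]
  have hconj : (Q * P⁻¹).map (starRingEnd ℂ) = P⁻¹ᴴ * Qᴴ := by
    rw [← conjTranspose_mul, conjTranspose, hQsymm]
    rfl
  rw [matImagPart, matImagPart, hconj, ← hherm, Matrix.mul_smul, Matrix.smul_mul,
    Matrix.mul_sub, Matrix.sub_mul, ← Matrix.mul_assoc, hPinvH, Matrix.one_mul,
    ← Matrix.mul_assoc, Matrix.mul_assoc _ P, hPinv, Matrix.mul_one]
end

section
/- Let m ≥ 1, let S = [[A, B], [C, D]] be an element of Sp(2m, ℝ) written in m×m blocks, and let 𝒩 be a symmetric complex m×m matrix whose imaginary part is negative definite. Then A + B𝒩 is invertible, and the transformed matrix 𝒩̃ := (C + D𝒩)(A + B𝒩)⁻¹ is again symmetric with negative definite imaginary part. -/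
open Matrix
open scoped ComplexOrder

theorem matImagPart_of_isSymm {m : ℕ} {N : Matrix (Fin m) (Fin m) ℂ} (hN : N.IsSymm) :
    matImagPart N = ((2 : ℂ) * Complex.I)⁻¹ • (N - Nᴴ) := by
  have h : N.map (starRingEnd ℂ) = Nᴴ := by
    conv_rhs => rw [← hN.eq]
    rfl
  rw [matImagPart, h]

/-- The symplectic form, evaluated on the graphs of `Pᵀ` and `N`, is preserved by a matrix whose
blocks satisfy the symplectic relations. -/
theorem symplectic_form_graph {m : ℕ} {R : Type*} [CommRing R]
    {a b c d : Matrix (Fin m) (Fin m) R}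
    (hac : aᵀ * c = cᵀ * a) (hbd : bᵀ * d = dᵀ * b)
    (had : aᵀ * d - cᵀ * b = 1) (hda : dᵀ * a - bᵀ * c = 1) (P N : Matrix (Fin m) (Fin m) R) :
    (aᵀ + P * bᵀ) * (c + d * N) - (cᵀ + P * dᵀ) * (a + b * N) = N - P := by
  calc _ = (aᵀ * c - cᵀ * a) + (aᵀ * d - cᵀ * b) * N - P * (dᵀ * a - bᵀ * c)
        + P * (bᵀ * d - dᵀ * b) * N := by noncomm_ring
    _ = N - P := by rw [hac, hbd, had, hda]; simp

theorem isSymm_mul_inv_of_transpose_mul_eq {m : ℕ} {R : Type*} [CommRing R]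
    {X Y : Matrix (Fin m) (Fin m) R} (hX : IsUnit X) (h : Xᵀ * Y = Yᵀ * X) :
    (Y * X⁻¹).IsSymm := by
  have hd := (Matrix.isUnit_iff_isUnit_det X).1 hX
  have hd' : IsUnit Xᵀ.det := by rwa [det_transpose]
  calc (Y * X⁻¹)ᵀ = (Xᵀ)⁻¹ * (Yᵀ * X) * X⁻¹ := by
        rw [transpose_mul, transpose_nonsing_inv, Matrix.mul_assoc, Matrix.mul_assoc,
          mul_nonsing_inv X hd, Matrix.mul_one]
    _ = Y * X⁻¹ := by
        rw [← h, ← Matrix.mul_assoc, nonsing_inv_mul _ hd', Matrix.one_mul]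

/-- If `S = [[A,B],[C,D]] ∈ Sp(2m,ℝ)` and `𝒩` is a symmetric complex
`m×m` matrix with negative definite imaginary part, then `A + B𝒩` is invertible and
`𝒩̃ := (C + D𝒩)(A + B𝒩)⁻¹` is again symmetric with negative definite imaginary part. -/
theorem symplectic_transform_preserves_symm_negDef (m : ℕ) (hm : 1 ≤ m)
    (A B C D : Matrix (Fin m) (Fin m) ℝ)
    (hS : (Matrix.fromBlocks A B C D)ᵀ *
        (Matrix.fromBlocks 0 1 (-1) 0 : Matrix (Fin m ⊕ Fin m) (Fin m ⊕ Fin m) ℝ) *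
        Matrix.fromBlocks A B C D =
        (Matrix.fromBlocks 0 1 (-1) 0 : Matrix (Fin m ⊕ Fin m) (Fin m ⊕ Fin m) ℝ))
    (N : Matrix (Fin m) (Fin m) ℂ) (hNsym : N.IsSymm)
    (hNneg : (-(matImagPart N)).PosDef) :
    IsUnit (A.map Complex.ofReal + B.map Complex.ofReal * N) ∧
    ((C.map Complex.ofReal + D.map Complex.ofReal * N) *
      (A.map Complex.ofReal + B.map Complex.ofReal * N)⁻¹).IsSymm ∧
    (-(matImagPart ((C.map Complex.ofReal + D.map Complex.ofReal * N) *
      (A.map Complex.ofReal + B.map Complex.ofReal * N)⁻¹))).PosDef := by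
  have hT : ∀ M : Matrix (Fin m) (Fin m) ℝ,
      (M.map Complex.ofReal)ᴴ = (M.map Complex.ofReal)ᵀ := fun M => by
    ext i j
    simp
  have hmap : ∀ M M' : Matrix (Fin m) (Fin m) ℝ, (Mᵀ * M').map Complex.ofReal =
      (M.map Complex.ofReal)ᵀ * M'.map Complex.ofReal := fun M M' => by
    rw [← transpose_map]
    exact Matrix.map_mul (f := Complex.ofRealHom)
  have hone : (1 : Matrix (Fin m) (Fin m) ℝ).map Complex.ofReal = 1 := by simp
  simp only [fromBlocks_transpose, fromBlocks_multiply, fromBlocks_inj, Matrix.mul_zero,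
    Matrix.mul_one, Matrix.mul_neg, Matrix.neg_mul, zero_add, add_zero] at hS
  obtain ⟨h₁, h₂, h₃, h₄⟩ := hS
  have hac : Aᵀ * C = Cᵀ * A := by rw [← sub_eq_zero, ← h₁]; abel
  have hbd : Bᵀ * D = Dᵀ * B := by rw [← sub_eq_zero, ← h₄]; abel
  have had : Aᵀ * D = 1 + Cᵀ * B := by rw [← h₂]; abel
  have hda : Dᵀ * A = 1 + Bᵀ * C := by rw [← neg_neg (1 : Matrix (Fin m) (Fin m) ℝ), ← h₃]; abel
  replace hac := congrArg (fun M => M.map Complex.ofReal) hac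
  replace hbd := congrArg (fun M => M.map Complex.ofReal) hbd
  replace had := congrArg (fun M => M.map Complex.ofReal) had
  replace hda := congrArg (fun M => M.map Complex.ofReal) hda
  simp only [Matrix.map_add _ Complex.ofReal_add, hmap, hone] at hac hbd had hda
  have key := symplectic_form_graph hac hbd (sub_eq_of_eq_add had) (sub_eq_of_eq_add hda)
  set a := A.map Complex.ofReal
  set b := B.map Complex.ofReal
  set c := C.map Complex.ofReal
  set d := D.map Complex.ofReal
  have hXY : (a + b * N)ᴴ * (c + d * N) - (c + d * N)ᴴ * (a + b * N) = N - Nᴴ := by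
    simpa only [conjTranspose_add, conjTranspose_mul, a, b, c, d, hT] using key Nᴴ N
  have hXYt : (a + b * N)ᵀ * (c + d * N) = (c + d * N)ᵀ * (a + b * N) := by
    rw [← sub_eq_zero]
    simpa only [transpose_add, transpose_mul, hNsym.eq, sub_self] using key N N
  generalize a + b * N = X at *
  generalize c + d * N = Y at *
  rw [matImagPart_of_isSymm hNsym, ← hXY] at hNneg
  have hX : IsUnit X := by
    rw [← Matrix.mulVec_injective_iff_isUnit, ← Matrix.coe_mulVecLin, ← LinearMap.ker_eq_bot,
      LinearMap.ker_eq_bot']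
    intro v hv
    rw [Matrix.mulVecLin_apply] at hv
    by_contra hne
    have hpos := hNneg.dotProduct_mulVec_pos hne
    have hv' : star v ᵥ* Xᴴ = 0 := by rw [← star_mulVec, hv, star_zero]
    simp [smul_mulVec, sub_mulVec, ← mulVec_mulVec, hv, dotProduct_mulVec, hv'] at hpos
  have hsym := isSymm_mul_inv_of_transpose_mul_eq hX hXYt
  refine ⟨hX, hsym, ?_⟩
  have hd := (Matrix.isUnit_iff_isUnit_det X).1 hX
  have hXX : (X⁻¹)ᴴ * Xᴴ = 1 := by
    rw [← conjTranspose_mul, mul_nonsing_inv X hd, conjTranspose_one]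
  have hinj : Function.Injective (X⁻¹).mulVec :=
    Matrix.mulVec_injective_iff_isUnit.2 ((Matrix.isUnit_nonsing_inv_iff).2 hX)
  convert hNneg.conjTranspose_mul_mul_same hinj using 1
  rw [matImagPart_of_isSymm hsym, Matrix.mul_neg, Matrix.neg_mul, Matrix.mul_smul,
    Matrix.smul_mul, Matrix.mul_sub, Matrix.sub_mul, ← Matrix.mul_assoc, hXX, Matrix.one_mul,
    Matrix.mul_assoc, Matrix.mul_assoc, mul_nonsing_inv X hd, Matrix.mul_one, conjTranspose_mul]
end

section
/- Let m ≥ 1 and let S = [[A, B], [C, D]] be an invertible real 2m×2m matrix written in m×m blocks. Suppose that for every symmetric complex m×m matrix 𝒩 such that A + B𝒩 is invertible, the matrix (C + D𝒩)(A + B𝒩)⁻¹ is symmetric. Then there exists a nonzero real number λ such that SᵀΩS = λΩ; that is, S is, up to a nonzero real rescaling, an element of the real symplectic group. -/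
open Matrix

/-- A symmetric real matrix can send a nonzero vector to any prescribed vector. -/
theorem exists_isSymm_mulVec_eq {n : Type*} [Fintype n] {x : n → ℝ} (hx : x ≠ 0) (v : n → ℝ) :
    ∃ N : Matrix n n ℝ, N.IsSymm ∧ N *ᵥ x = v := by
  have hs : x ⬝ᵥ x ≠ 0 := fun h => hx (dotProduct_self_eq_zero.mp h)
  refine ⟨(x ⬝ᵥ x)⁻¹ • (vecMulVec v x + vecMulVec x v) -
    ((v ⬝ᵥ x) * (x ⬝ᵥ x)⁻¹ ^ 2) • vecMulVec x x, ?_, ?_⟩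
  · ext i j
    simp [vecMulVec_apply]
    ring
  · ext i
    simp [sub_mulVec, add_mulVec, smul_mulVec, vecMulVec_mulVec]
    field_simp
    ring

/-- If `M` sends some kernel vector of `A` outside the range of `A`, then the rank of `A + t M`
exceeds that of `A` for some `t`. -/
theorem exists_rank_lt_rank_add_smul {n : Type*} [Fintype n]
    {A M : Matrix n n ℝ} {x : n → ℝ} (hx : A *ᵥ x = 0)
    (hM : M *ᵥ x ∉ LinearMap.range A.mulVecLin) :
    ∃ t : ℝ, A.rank < (A + t • M).rank := by
  obtain ⟨r, hr⟩ : ∃ r, A.rank = r := ⟨_, rfl⟩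
  obtain b : Module.Basis (Fin r) ℝ (LinearMap.range A.mulVecLin) :=
    Module.finBasisOfFinrankEq ℝ _ hr
  rw [hr]
  choose u hu using fun i => (b i).2
  let f : ℝ → Fin (r + 1) → n → ℝ :=
    fun t => Fin.cons (M *ᵥ x) fun i => (A + t • M) *ᵥ u i
  have hf : Continuous f := by
    refine continuous_pi fun i => ?_
    refine Fin.cases ?_ (fun i => ?_) i
    · simpa [f] using continuous_const
    · simp only [f, Fin.cons_succ, add_mulVec, smul_mulVec]
      fun_prop
  have h0 : LinearIndependent ℝ (f 0) := by
    have hb : (fun i => (A + (0 : ℝ) • M) *ᵥ u i) = fun i => (b i : n → ℝ) := by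
      funext i
      simpa using hu i
    have hspan : Submodule.span ℝ (Set.range fun i => (b i : n → ℝ)) ≤
        LinearMap.range A.mulVecLin := by
      rw [Submodule.span_le]
      rintro _ ⟨i, rfl⟩
      exact (b i).2
    refine linearIndependent_finCons.mpr ⟨?_, ?_⟩
    · rw [hb]
      exact b.linearIndependent.map' (LinearMap.range A.mulVecLin).subtype
        (Submodule.ker_subtype _)
    · rw [hb]
      exact fun h => hM (hspan h)
  have hev : ∀ᶠ t in nhdsWithin (0 : ℝ) {0}ᶜ, LinearIndependent ℝ (f t) :=
    (hf.continuousAt.eventually h0.eventually).filter_mono nhdsWithin_le_nhds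
  obtain ⟨t, ht, ht0⟩ := (hev.and self_mem_nhdsWithin).exists
  refine ⟨t, ?_⟩
  have hle : Submodule.span ℝ (Set.range (f t)) ≤ LinearMap.range (A + t • M).mulVecLin := by
    rw [Submodule.span_le]
    rintro _ ⟨i, rfl⟩
    refine Fin.cases ?_ (fun i => ?_) i
    · refine ⟨t⁻¹ • x, ?_⟩
      have : t ≠ 0 := ht0
      simp [f, add_mulVec, smul_mulVec, hx, this]
    · exact ⟨u i, rfl⟩
  have hcard := Submodule.finrank_mono hle
  rw [finrank_span_eq_card ht, Fintype.card_fin] at hcard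
  exact hcard

/-- If `[A, B]` has full row rank, then `A + B N` is invertible for some symmetric `N`. -/
theorem exists_isSymm_isUnit_add_mul {n : Type*} [Fintype n] [DecidableEq n]
    (A B : Matrix n n ℝ) (hAB : ∀ y, ∃ u v, A *ᵥ u + B *ᵥ v = y) :
    ∃ N : Matrix n n ℝ, N.IsSymm ∧ IsUnit (A + B * N) := by
  induction hk : Fintype.card n - A.rank using Nat.strong_induction_on generalizing A with
  | _ k ih =>
    subst hk
    by_cases hA : IsUnit A
    · exact ⟨0, isSymm_zero, by simpa using hA⟩
    obtain ⟨x, hx0, hx⟩ := exists_mulVec_eq_zero_iff.mpr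
      (by simpa [isUnit_iff_isUnit_det] using hA : A.det = 0)
    obtain ⟨y, hy⟩ : ∃ y, ∀ u, A *ᵥ u ≠ y := by
      simpa [← mulVec_surjective_iff_isUnit, Function.Surjective] using hA
    obtain ⟨u, v, huv⟩ := hAB y
    obtain ⟨N, hN, hNx⟩ := exists_isSymm_mulVec_eq hx0 v
    obtain ⟨t, ht⟩ := exists_rank_lt_rank_add_smul (M := B * N) hx (by
      rintro ⟨w, hw⟩
      refine hy (u + w) ?_
      rw [mulVecLin_apply, ← mulVec_mulVec, hNx] at hw
      rw [mulVec_add, hw, huv])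
    have hle := (A + t • (B * N)).rank_le_card_width
    obtain ⟨N', hN', hU⟩ := ih _ (by omega) (A + t • (B * N)) (fun y => by
      obtain ⟨u, v, h⟩ := hAB y
      refine ⟨u, v - t • N *ᵥ u, ?_⟩
      rw [← h]
      simp only [add_mulVec, smul_mulVec, mulVec_sub, mulVec_smul, mulVec_mulVec]
      abel) rfl
    refine ⟨t • N + N', (hN.smul t).add hN', ?_⟩
    rwa [mul_add, mul_smul_comm, ← add_assoc]

/-- A matrix `P` with `P M = M Pᵀ` for all symmetric `M` is scalar. -/
theorem exists_eq_smul_one_of_mul_isSymm {n : Type*} [Fintype n] [DecidableEq n]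
    {P : Matrix n n ℝ} (h : ∀ M : Matrix n n ℝ, M.IsSymm → P * M = M * Pᵀ) :
    ∃ c : ℝ, P = c • (1 : Matrix n n ℝ) := by
  have hP : P = Pᵀ := by simpa using h 1 isSymm_one
  have hc : ∀ M : Matrix n n ℝ, M.IsSymm → Commute M P := fun M hM => by
    have := h M hM
    rw [← hP] at this
    exact this.symm
  obtain ⟨c, hc⟩ := mem_range_scalar_of_commute_single (M := P) fun i j hij => by
    have h1 := hc (single i i 1) (by simp [IsSymm])
    have h2 := hc (single i j 1 + single j i 1) (by simp [IsSymm, add_comm])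
    have h3 := h1.mul_left h2
    simpa [mul_add, hij] using h3
  exact ⟨c, by rw [← hc, scalar_apply, smul_one_eq_diagonal]⟩

/-- If `(C + D N) (A + B N)⁻¹` is symmetric for every symmetric `N` making `A + B N` invertible
and `A` itself is invertible, then the blocks satisfy the symplectic relations up to a scalar. -/
theorem symplectic_relations_of_isUnit {n : Type*} [Fintype n] [DecidableEq n]
    {A B C D : Matrix n n ℝ} (hA : IsUnit A)
    (h : ∀ N : Matrix n n ℝ, N.IsSymm → IsUnit (A + B * N) →
      ((A + B * N)ᵀ * (C + D * N)).IsSymm) :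
    ∃ c : ℝ, Aᵀ * C = Cᵀ * A ∧ Bᵀ * D = Dᵀ * B ∧
      Aᵀ * D - Cᵀ * B = c • (1 : Matrix n n ℝ) := by
  have hAC : Aᵀ * C = Cᵀ * A := by
    have := (h 0 isSymm_zero (by simpa using hA)).eq
    simpa using this.symm
  have key : ∀ M : Matrix n n ℝ, M.IsSymm →
      (Aᵀ * D - Cᵀ * B) * M = M * (Aᵀ * D - Cᵀ * B)ᵀ ∧ M * (Bᵀ * D - Dᵀ * B) * M = 0 := by
    intro M hM
    have hcont : ∀ s : ℝ, ∀ᶠ t in nhdsWithin (0 : ℝ) {0}ᶜ, IsUnit (A + B * ((s * t) • M)) := by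
      intro s
      have hdet : Continuous fun t : ℝ => (A + B * ((s * t) • M)).det := by fun_prop
      have h0 : (A + B * ((s * 0) • M)).det ≠ 0 := by
        simpa [isUnit_iff_isUnit_det] using hA
      filter_upwards [(hdet.continuousAt.eventually_ne h0).filter_mono nhdsWithin_le_nhds]
        with t ht
      rwa [isUnit_iff_isUnit_det, isUnit_iff_ne_zero]
    obtain ⟨t, ⟨hp, hm⟩, ht⟩ :=
      (((hcont 1).and (hcont (-1))).and self_mem_nhdsWithin).exists
    have ht : t ≠ 0 := ht
    set L := (Aᵀ * D - Cᵀ * B) * M - M * (Aᵀ * D - Cᵀ * B)ᵀ with hL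
    set Q := M * (Bᵀ * D - Dᵀ * B) * M with hQ
    have expand : ∀ s : ℝ, IsUnit (A + B * (s • M)) → s • L + (s * s) • Q = 0 := by
      intro s hs
      have := (h (s • M) (hM.smul s) hs).eq
      simp only [transpose_mul, transpose_add, transpose_smul, transpose_transpose, hM.eq,
        mul_add, add_mul, smul_mul_assoc, mul_smul_comm, smul_smul, smul_add] at this
      rw [← sub_eq_zero] at this
      rw [← neg_eq_zero, ← this, hL, hQ]
      simp only [transpose_mul, transpose_sub, transpose_transpose, mul_sub, sub_mul, smul_sub,
        hAC, Matrix.mul_assoc]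
      abel
    have e1 := expand t (by simpa using hp)
    have e2 := expand (-t) (by simpa using hm)
    have hQ0 : (2 * (t * t)) • Q = 0 := by
      have : (2 * (t * t)) • Q = (t • L + (t * t) • Q) + ((-t) • L + (-t * -t) • Q) := by module
      rw [this, e1, e2, add_zero]
    have hL0 : (2 * t) • L = 0 := by
      have : (2 * t) • L = (t • L + (t * t) • Q) - ((-t) • L + (-t * -t) • Q) := by module
      rw [this, e1, e2, sub_zero]
    exact ⟨sub_eq_zero.mp ((smul_eq_zero.mp hL0).resolve_left (by simpa using ht)),
      (smul_eq_zero.mp hQ0).resolve_left (by simpa using ht)⟩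
  obtain ⟨c, hc⟩ := exists_eq_smul_one_of_mul_isSymm fun M hM => (key M hM).1
  exact ⟨c, hAC, sub_eq_zero.mp (by simpa using (key 1 isSymm_one).2), hc⟩

/-- `X Y⁻¹` is symmetric only if `Yᵀ X` is. -/
theorem isSymm_transpose_mul_of_isSymm_mul_inv {n R : Type*} [Fintype n] [DecidableEq n]
    [CommRing R] {X Y : Matrix n n R} (hY : IsUnit Y) (h : (X * Y⁻¹).IsSymm) :
    (Yᵀ * X).IsSymm := by
  have hX : X = X * Y⁻¹ * Y := by
    rw [Matrix.mul_assoc, nonsing_inv_mul _ ((isUnit_iff_isUnit_det _).mp hY), Matrix.mul_one]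
  generalize X * Y⁻¹ = Z at h hX
  rw [hX, IsSymm, transpose_mul, transpose_mul, transpose_transpose, h.eq, Matrix.mul_assoc]

/-- If `S = [[A,B],[C,D]]` is an invertible real `2m×2m` matrix such that
`𝒩 ↦ (C + D𝒩)(A + B𝒩)⁻¹` maps every symmetric complex matrix `𝒩` (with `A + B𝒩`
invertible) to a symmetric matrix, then `SᵀΩS = λΩ` for some nonzero real `λ`,
i.e. `S` is a real symplectic matrix up to a nonzero rescaling. -/
theorem symm_preserving_implies_symplectic_up_to_scale (m : ℕ) (hm : 1 ≤ m)
    (A B C D : Matrix (Fin m) (Fin m) ℝ)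
    (hSinv : IsUnit (Matrix.fromBlocks A B C D))
    (h : ∀ N : Matrix (Fin m) (Fin m) ℂ, N.IsSymm →
      IsUnit (A.map Complex.ofReal + B.map Complex.ofReal * N) →
      ((C.map Complex.ofReal + D.map Complex.ofReal * N) *
        (A.map Complex.ofReal + B.map Complex.ofReal * N)⁻¹).IsSymm) :
    ∃ lam : ℝ, lam ≠ 0 ∧
      (Matrix.fromBlocks A B C D)ᵀ *
          (Matrix.fromBlocks 0 1 (-1) 0 : Matrix (Fin m ⊕ Fin m) (Fin m ⊕ Fin m) ℝ) *
          Matrix.fromBlocks A B C D =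
        lam • (Matrix.fromBlocks 0 1 (-1) 0 : Matrix (Fin m ⊕ Fin m) (Fin m ⊕ Fin m) ℝ) := by
  have hreal : ∀ N : Matrix (Fin m) (Fin m) ℝ, N.IsSymm → IsUnit (A + B * N) →
      ((A + B * N)ᵀ * (C + D * N)).IsSymm := by
    intro N hN hU
    have hmap : ∀ X Y : Matrix (Fin m) (Fin m) ℝ,
        X.map Complex.ofReal + Y.map Complex.ofReal * N.map Complex.ofReal =
          Complex.ofRealHom.mapMatrix (X + Y * N) := fun X Y => by
      rw [map_add, map_mul]
      rfl
    have hUc : IsUnit (Complex.ofRealHom.mapMatrix (A + B * N)) := hU.map _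
    have hs := h (N.map Complex.ofReal) (hN.map _) (by rwa [hmap])
    rw [hmap, hmap] at hs
    have := isSymm_transpose_mul_of_isSymm_mul_inv hUc hs
    apply Matrix.map_injective Complex.ofReal_injective
    have h2 : ((A + B * N)ᵀ * (C + D * N)).map Complex.ofReal =
        (Complex.ofRealHom.mapMatrix (A + B * N))ᵀ * Complex.ofRealHom.mapMatrix (C + D * N) :=
      Matrix.map_mul (f := Complex.ofRealHom)
    change (((A + B * N)ᵀ * (C + D * N)).map Complex.ofReal)ᵀ = _
    exact (congrArg transpose h2).trans (this.eq.trans h2.symm)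
  obtain ⟨N, hN, hU⟩ := exists_isSymm_isUnit_add_mul A B fun y => by
    obtain ⟨z, hz⟩ := mulVec_surjective_iff_isUnit.mpr hSinv (Sum.elim y 0)
    refine ⟨z ∘ Sum.inl, z ∘ Sum.inr, ?_⟩
    rw [fromBlocks_mulVec] at hz
    exact congrArg (· ∘ Sum.inl) hz
  obtain ⟨c, hAC, hBD, hAD⟩ := symplectic_relations_of_isUnit (B := B) (C := C + D * N) (D := D) hU
    fun M hM hUM => by
      have := hreal (N + M) (hN.add hM) (by rwa [mul_add, ← add_assoc])
      rwa [mul_add B, mul_add D, ← add_assoc, ← add_assoc] at this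
  have hAD' : Aᵀ * D - Cᵀ * B = c • 1 := by
    rw [← hAD]
    simp only [transpose_add, transpose_mul, hN.eq, add_mul, Matrix.mul_assoc, hBD]
    abel
  have hDA : Dᵀ * A - Bᵀ * C = c • 1 := by
    simpa using congrArg transpose hAD'
  have hAC' : Aᵀ * C - Cᵀ * A = 0 := by
    have e : Aᵀ * C - Cᵀ * A = ((A + B * N)ᵀ * (C + D * N) - (C + D * N)ᵀ * (A + B * N))
        - (Aᵀ * D - Cᵀ * B) * N + N * (Dᵀ * A - Bᵀ * C) - N * (Bᵀ * D - Dᵀ * B) * N := by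
      simp only [transpose_add, transpose_mul, hN.eq]
      noncomm_ring
    rw [e, hAC, hAD', hDA, hBD]
    simp
  have hS : (fromBlocks A B C D)ᵀ * (fromBlocks 0 1 (-1) 0 : Matrix (Fin m ⊕ Fin m) _ ℝ) *
      fromBlocks A B C D = c • fromBlocks 0 1 (-1) 0 := by
    rw [fromBlocks_transpose, fromBlocks_multiply, fromBlocks_multiply, fromBlocks_smul]
    congr 1
    · refine Eq.trans ?_ (hAC'.trans (smul_zero c).symm)
      noncomm_ring
    · rw [← hAD']
      noncomm_ring
    · rw [smul_neg, ← hDA]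
      noncomm_ring
    · refine Eq.trans ?_ ((sub_eq_zero.mpr hBD).trans (smul_zero c).symm)
      noncomm_ring
  refine ⟨c, ?_, hS⟩
  rintro rfl
  rw [zero_smul, hSinv.mul_left_eq_zero] at hS
  have hSt : IsUnit (fromBlocks A B C D)ᵀ := (isUnit_transpose _).mpr hSinv
  rw [hSt.mul_right_eq_zero] at hS
  have := congrFun (congrFun hS (Sum.inl ⟨0, hm⟩)) (Sum.inr ⟨0, hm⟩)
  simp at this
end

section
/- Let U ⊆ ℂⁿ be open and let X, F : U → ℂⁿ be holomorphic maps satisfying the rigid special Kähler constraint, i.e. DX(z)ᵀ DF(z) is symmetric for all z ∈ U, and suppose DX(z) is invertible for every z ∈ U. Then a holomorphic prepotential exists locally: for every z₀ ∈ U there exist an open neighbourhood U₀ ⊆ U of z₀, an open set W ⊆ ℂⁿ with X(U₀) ⊆ W, and a holomorphic function 𝔉 : W → ℂ such that F_A(z) = (∂𝔉/∂X^A)(X(z)) for all z ∈ U₀ and all A = 1, …, n. -/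
open Matrix

/-- The complex Jacobian matrix of a map `f : ℂⁿ → ℂⁿ` at `z`, with entries
`(jacobian f z) A α = ∂ f^A / ∂ z^α (z)`. -/
noncomputable def jacobian {n : ℕ} (f : (Fin n → ℂ) → (Fin n → ℂ)) (z : Fin n → ℂ) :
    Matrix (Fin n) (Fin n) ℂ :=
  Matrix.of fun A α => fderiv ℂ f z (Pi.single α 1) A

open Metric in
/-- The derivative of a holomorphic map on an open subset of a finite-dimensional complex normed
space is continuous. -/
theorem continuousAt_fderiv_of_differentiableOn_complex {E G : Type*} [NormedAddCommGroup E]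
    [NormedSpace ℂ E] [FiniteDimensional ℂ E] [NormedAddCommGroup G] [NormedSpace ℂ G]
    {f : E → G} {U : Set E} (hU : IsOpen U) (hf : DifferentiableOn ℂ f U) {z₀ : E} (hz₀ : z₀ ∈ U) :
    ContinuousAt (fderiv ℂ f) z₀ := by
  have : ProperSpace E := FiniteDimensional.proper ℂ E
  obtain ⟨R, hR, hRU⟩ := nhds_basis_closedBall.mem_iff.1 (hU.mem_nhds hz₀)
  have huc : UniformContinuousOn f (closedBall z₀ R) :=
    (isCompact_closedBall z₀ R).uniformContinuousOn_of_continuous (hf.continuousOn.mono hRU)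
  rw [Metric.continuousAt_iff]
  intro ε hε
  have hr : 0 < R / 2 := half_pos hR
  obtain ⟨δ, hδ, hfδ⟩ := Metric.uniformContinuousOn_iff.1 huc (ε / 2 * (R / 2)) (by positivity)
  refine ⟨min δ (R / 2), lt_min hδ hr, fun {z} hz ↦ ?_⟩
  have hmem : ∀ {w v : E} {t : ℂ}, dist w z₀ < R / 2 → ‖v‖ = 1 → ‖t‖ ≤ R / 2 →
      w + t • v ∈ closedBall z₀ R := by
    intro w v t hw hv ht
    rw [mem_closedBall, dist_eq_norm, add_sub_right_comm]
    refine (norm_add_le _ _).trans ?_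
    rw [norm_smul, hv, mul_one, ← dist_eq_norm]
    linarith
  have hderiv : ∀ {w v : E} {t : ℂ}, dist w z₀ < R / 2 → ‖v‖ = 1 → ‖t‖ ≤ R / 2 →
      HasDerivAt (fun s : ℂ ↦ f (w + s • v)) (fderiv ℂ f (w + t • v) v) t := by
    intro w v t hw hv ht
    have h1 : HasFDerivAt f (fderiv ℂ f (w + t • v)) (w + t • v) :=
      (hf.differentiableAt (hU.mem_nhds (hRU (hmem hw hv ht)))).hasFDerivAt
    have h2 : HasDerivAt (fun s : ℂ ↦ w + s • v) v t := by
      simpa using ((hasDerivAt_id t).smul_const v).const_add w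
    exact h1.comp_hasDerivAt t h2
  have hz' : dist z z₀ < R / 2 := hz.trans_le (min_le_right _ _)
  have hz₀' : dist z₀ z₀ < R / 2 := by simpa using hr
  rw [dist_eq_norm]
  refine lt_of_le_of_lt ?_ (half_lt_self hε)
  refine ContinuousLinearMap.opNorm_le_of_unit_norm (𝕜 := ℂ) (by positivity) fun v hv ↦ ?_
  have hd : ∀ t : ℂ, ‖t‖ ≤ R / 2 → HasDerivAt (fun s : ℂ ↦ f (z + s • v) - f (z₀ + s • v))
      (fderiv ℂ f (z + t • v) v - fderiv ℂ f (z₀ + t • v) v) t :=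
    fun t ht ↦ (hderiv hz' hv ht).sub (hderiv hz₀' hv ht)
  have hcl : DiffContOnCl ℂ (fun s : ℂ ↦ f (z + s • v) - f (z₀ + s • v)) (ball 0 (R / 2)) := by
    refine DifferentiableOn.diffContOnCl fun t ht ↦ ?_
    rw [closure_ball _ hr.ne', mem_closedBall_zero_iff] at ht
    exact (hd t ht).differentiableAt.differentiableWithinAt
  have hbound := Complex.norm_deriv_le_of_forall_mem_sphere_norm_le (C := ε / 2 * (R / 2)) hr hcl
    fun t ht ↦ by
      have ht' : ‖t‖ ≤ R / 2 := (mem_sphere_zero_iff_norm.1 ht).le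
      rw [← dist_eq_norm]
      refine (hfδ _ (hmem hz' hv ht') _ (hmem hz₀' hv ht') ?_).le
      simpa using hz.trans_le (min_le_left _ _)
  rw [(hd 0 (by simpa using hr.le)).deriv, mul_div_cancel_right₀ _ hr.ne'] at hbound
  simpa using hbound

theorem jacobian_mulVec {n : ℕ} (f : (Fin n → ℂ) → (Fin n → ℂ)) (z v : Fin n → ℂ) :
    jacobian f z *ᵥ v = fderiv ℂ f z v := by
  have : jacobian f z = LinearMap.toMatrix' (fderiv ℂ f z : (Fin n → ℂ) →ₗ[ℂ] (Fin n → ℂ)) := by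
    ext A α
    simp [jacobian, LinearMap.toMatrix'_apply]
  rw [this, LinearMap.toMatrix'_mulVec]
  rfl

theorem exists_continuousLinearEquiv_eq_fderiv {n : ℕ} {f : (Fin n → ℂ) → (Fin n → ℂ)}
    {z : Fin n → ℂ} (h : IsUnit (jacobian f z)) :
    ∃ e : (Fin n → ℂ) ≃L[ℂ] (Fin n → ℂ), (e : (Fin n → ℂ) →L[ℂ] (Fin n → ℂ)) = fderiv ℂ f z := by
  have hinj : Function.Injective (fderiv ℂ f z : (Fin n → ℂ) →ₗ[ℂ] (Fin n → ℂ)) := by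
    intro v w hvw
    apply Matrix.mulVec_injective_of_isUnit h
    simpa [jacobian_mulVec] using hvw
  refine ⟨(LinearEquiv.ofInjectiveEndo _ hinj).toContinuousLinearEquiv, ?_⟩
  ext v
  simp

theorem fderiv_dotProduct_comm_of_isSymm {n : ℕ} {X F : (Fin n → ℂ) → (Fin n → ℂ)}
    {z : Fin n → ℂ} (h : ((jacobian X z)ᵀ * jacobian F z).IsSymm) (a b : Fin n → ℂ) :
    fderiv ℂ F z a ⬝ᵥ fderiv ℂ X z b = fderiv ℂ F z b ⬝ᵥ fderiv ℂ X z a := by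
  have key : ∀ a b : Fin n → ℂ, fderiv ℂ F z a ⬝ᵥ fderiv ℂ X z b =
      b ⬝ᵥ (((jacobian X z)ᵀ * jacobian F z) *ᵥ a) := by
    intro a b
    rw [← jacobian_mulVec, ← jacobian_mulVec, ← Matrix.mulVec_mulVec, Matrix.dotProduct_mulVec,
      Matrix.dotProduct_mulVec, Matrix.vecMul_transpose, ← Matrix.dotProduct_mulVec, dotProduct_comm]
  rw [key, key, Matrix.dotProduct_mulVec, ← Matrix.mulVec_transpose, h.eq, dotProduct_comm]

/-- The pairing `u ↦ (v ↦ ∑ A, u A * v A)`, as a continuous linear map into the dual. -/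
noncomputable def dotProductCLM (n : ℕ) : (Fin n → ℂ) →L[ℂ] (Fin n → ℂ) →L[ℂ] ℂ :=
  ∑ A : Fin n, (ContinuousLinearMap.proj (R := ℂ) (φ := fun _ : Fin n ↦ ℂ) A).smulRight
    (ContinuousLinearMap.proj (R := ℂ) (φ := fun _ : Fin n ↦ ℂ) A)

theorem dotProductCLM_apply {n : ℕ} (u v : Fin n → ℂ) : dotProductCLM n u v = u ⬝ᵥ v := by
  simp [dotProductCLM, dotProduct]

/-- If `X, F : U → ℂⁿ` are holomorphic on an open set `U ⊆ ℂⁿ`,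
satisfy the rigid special Kähler constraint (`DX(z)ᵀ DF(z)` symmetric for all `z ∈ U`),
and `DX(z)` is invertible for every `z ∈ U`, then a holomorphic prepotential exists
locally: around every `z₀ ∈ U` there are an open neighbourhood `U₀ ⊆ U`, an open set
`W` containing `X(U₀)`, and a holomorphic `𝔉 : W → ℂ` with `F_A = (∂𝔉/∂X^A) ∘ X` on `U₀`. -/
theorem rigid_special_kahler_local_prepotential (n : ℕ)
    (U : Set (Fin n → ℂ)) (hU : IsOpen U)
    (X F : (Fin n → ℂ) → (Fin n → ℂ))
    (hX : DifferentiableOn ℂ X U) (hF : DifferentiableOn ℂ F U)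
    (hconstraint : ∀ z ∈ U, ((jacobian X z)ᵀ * jacobian F z).IsSymm)
    (hinv : ∀ z ∈ U, IsUnit (jacobian X z))
    (z₀ : Fin n → ℂ) (hz₀ : z₀ ∈ U) :
    ∃ U₀ : Set (Fin n → ℂ), IsOpen U₀ ∧ z₀ ∈ U₀ ∧ U₀ ⊆ U ∧
      ∃ W : Set (Fin n → ℂ), IsOpen W ∧ X '' U₀ ⊆ W ∧
        ∃ 𝔉 : (Fin n → ℂ) → ℂ, DifferentiableOn ℂ 𝔉 W ∧
          ∀ z ∈ U₀, ∀ A : Fin n, F z A = fderiv ℂ 𝔉 (X z) (Pi.single A 1) := by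
  obtain ⟨e₀, he₀⟩ := exists_continuousLinearEquiv_eq_fderiv (hinv z₀ hz₀)
  have hstrict : HasStrictFDerivAt X (e₀ : (Fin n → ℂ) →L[ℂ] (Fin n → ℂ)) z₀ := by
    rw [he₀]
    refine hasStrictFDerivAt_of_hasFDerivAt_of_continuousAt ?_
      (continuousAt_fderiv_of_differentiableOn_complex hU hX hz₀)
    filter_upwards [hU.mem_nhds hz₀] with z hz
    exact (hX.differentiableAt (hU.mem_nhds hz)).hasFDerivAt
  let Φ := (hstrict.toOpenPartialHomeomorph X).restrOpen U hU
  have hΦ : ∀ z, Φ z = X z := fun _ ↦ rfl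
  have hz₀Φ : z₀ ∈ Φ.source := ⟨hstrict.mem_toOpenPartialHomeomorph_source, hz₀⟩
  have hΦU : Φ.source ⊆ U := fun z hz ↦ hz.2
  obtain ⟨r, hr, hball⟩ := Metric.isOpen_iff.1 Φ.open_target (X z₀) (Φ.map_source hz₀Φ)
  have hω : ∀ x ∈ Metric.ball (X z₀) r, ∃ e : (Fin n → ℂ) ≃L[ℂ] (Fin n → ℂ),
      (e : (Fin n → ℂ) →L[ℂ] (Fin n → ℂ)) = fderiv ℂ X (Φ.symm x) ∧
      HasFDerivAt (fun y ↦ dotProductCLM n (F (Φ.symm y)))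
        ((dotProductCLM n).comp ((fderiv ℂ F (Φ.symm x)).comp
          (e.symm : (Fin n → ℂ) →L[ℂ] (Fin n → ℂ)))) x := by
    intro x hx
    have hz : Φ.symm x ∈ U := hΦU (Φ.map_target (hball hx))
    obtain ⟨e, he⟩ := exists_continuousLinearEquiv_eq_fderiv (hinv _ hz)
    refine ⟨e, he, ?_⟩
    have hXd : HasFDerivAt Φ (e : (Fin n → ℂ) →L[ℂ] (Fin n → ℂ)) (Φ.symm x) := by
      rw [he]
      exact (hX.differentiableAt (hU.mem_nhds hz)).hasFDerivAt
    have hs := Φ.hasFDerivAt_symm (hball hx) hXd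
    have hFd := (hF.differentiableAt (hU.mem_nhds hz)).hasFDerivAt
    exact (dotProductCLM n).hasFDerivAt.comp x (hFd.comp x hs)
  obtain ⟨𝔉, h𝔉⟩ := (convex_ball (X z₀) r).exists_forall_hasFDerivAt_of_fderiv_symmetric
    (𝕜 := ℂ) (ω := fun y ↦ dotProductCLM n (F (Φ.symm y))) Metric.isOpen_ball
    (fun x hx ↦ by
      obtain ⟨e, -, hd⟩ := hω x hx
      exact (hd.restrictScalars ℝ).differentiableAt.differentiableWithinAt)
    (fun x hx u v ↦ by
      obtain ⟨e, he, hd⟩ := hω x hx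
      have hsymm := fderiv_dotProduct_comm_of_isSymm
        (hconstraint _ (hΦU (Φ.map_target (hball hx)))) (e.symm u) (e.symm v)
      rw [(hd.restrictScalars ℝ).fderiv]
      simpa [dotProductCLM_apply, ← he] using hsymm)
  refine ⟨Φ.source ∩ Φ ⁻¹' Metric.ball (X z₀) r, Φ.isOpen_inter_preimage Metric.isOpen_ball,
    ⟨hz₀Φ, Metric.mem_ball_self hr⟩, fun z hz ↦ hΦU hz.1, Metric.ball (X z₀) r,
    Metric.isOpen_ball, ?_, 𝔉,
    fun x hx ↦ (h𝔉 x hx).differentiableAt.differentiableWithinAt, ?_⟩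
  · rintro _ ⟨z, hz, rfl⟩
    exact hz.2
  · intro z hz A
    rw [(h𝔉 (X z) hz.2).fderiv, dotProductCLM_apply, ← hΦ, Φ.left_inv hz.1]
    simp
end

section
/- Let n ≥ 1, let U ⊆ ℂⁿ be open, and let v = (Z, F) : U → ℂ^{n+1} × ℂ^{n+1} be holomorphic, satisfying for all z ∈ U and all α, β = 1, …, n the constraints ⟨v(z), ∂_α v(z)⟩ = 0 and ⟨∂_α v(z), ∂_β v(z)⟩ = 0. Suppose that at a point z₀ ∈ U the (n+1)×(n+1) matrix whose columns are Z(z₀), ∂_1 Z(z₀), …, ∂_n Z(z₀) is invertible. Then a holomorphic prepotential, homogeneous of degree two, exists locally: there are an open neighbourhood U₀ ⊆ U of z₀, an open set W ⊆ ℂ^{n+1} with Z(U₀) ⊆ W, and a holomorphic function 𝔉 : W → ℂ satisfying 𝔉(λX) = λ²𝔉(X) whenever X ∈ W, λ ∈ ℂ and λX ∈ W, such that F_I(z) = (∂𝔉/∂X^I)(Z(z)) for all z ∈ U₀ and all I = 0, …, n. -/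
open Matrix

open Filter Topology Metric in
/-- The derivative of a holomorphic map on an open subset of a proper space is continuous. -/
theorem continuousOn_fderiv_of_differentiableOn_complex {E G : Type*}
    [NormedAddCommGroup E] [NormedSpace ℂ E] [ProperSpace E]
    [NormedAddCommGroup G] [NormedSpace ℂ G] {f : E → G} {U : Set E}
    (hU : IsOpen U) (hf : DifferentiableOn ℂ f U) : ContinuousOn (fderiv ℂ f) U := by
  intro x hx
  apply ContinuousAt.continuousWithinAt
  obtain ⟨ρ, hρ, hρU⟩ := nhds_basis_closedBall.mem_iff.1 (hU.mem_nhds hx)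
  set r := ρ / 2 with hr
  have hr0 : 0 < r := by positivity
  have huc := (isCompact_closedBall x ρ).uniformContinuousOn_of_continuous
    (hf.continuousOn.mono hρU)
  rw [Metric.uniformContinuousOn_iff_le] at huc
  rw [Metric.continuousAt_iff']
  intro ε hε
  obtain ⟨δ, hδ, hfδ⟩ := huc (ε / 2 * r) (by positivity)
  filter_upwards [ball_mem_nhds x (lt_min hδ hr0)] with w hw
  obtain ⟨hwδ, hwr⟩ := lt_min_iff.1 (mem_ball.1 hw)
  rw [dist_eq_norm]
  refine lt_of_le_of_lt (ContinuousLinearMap.opNorm_le_bound _ (by positivity) fun v => ?_)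
    (half_lt_self hε)
  rcases eq_or_ne v 0 with rfl | hv
  · simp
  have hv0 : 0 < ‖v‖ := norm_pos_iff.2 hv
  have hmem : ∀ y, dist y x < r → ∀ ζ ∈ closedBall (0 : ℂ) (r / ‖v‖),
      y + ζ • v ∈ closedBall x ρ := by
    intro y hy ζ hζ
    have h1 : ‖ζ‖ * ‖v‖ ≤ r := by
      rw [mem_closedBall_zero_iff, le_div_iff₀ hv0] at hζ
      exact hζ
    rw [mem_closedBall, dist_eq_norm]
    rw [dist_eq_norm] at hy
    calc ‖y + ζ • v - x‖ = ‖(y - x) + ζ • v‖ := by congr 1; abel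
      _ ≤ ‖y - x‖ + ‖ζ • v‖ := norm_add_le _ _
      _ ≤ ρ := by rw [norm_smul]; linarith
  have hxr : dist x x < r := by simpa using hr0
  have hderiv : ∀ y, dist y x < r → ∀ ζ ∈ closedBall (0 : ℂ) (r / ‖v‖),
      HasDerivAt (fun ζ : ℂ => f (y + ζ • v)) (fderiv ℂ f (y + ζ • v) v) ζ := by
    intro y hy ζ hζ
    have h1 : HasDerivAt (fun ζ : ℂ => y + ζ • v) v ζ := by
      simpa using ((hasDerivAt_id ζ).smul_const v).const_add y
    exact ((hf.differentiableAt
      (hU.mem_nhds (hρU (hmem y hy ζ hζ)))).hasFDerivAt).comp_hasDerivAt ζ h1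
  have hd : ∀ ζ ∈ closedBall (0 : ℂ) (r / ‖v‖),
      HasDerivAt (fun ζ : ℂ => f (w + ζ • v) - f (x + ζ • v))
        (fderiv ℂ f (w + ζ • v) v - fderiv ℂ f (x + ζ • v) v) ζ :=
    fun ζ hζ => (hderiv w hwr ζ hζ).sub (hderiv x hxr ζ hζ)
  have hR : 0 < r / ‖v‖ := by positivity
  have key := Complex.norm_deriv_le_of_forall_mem_sphere_norm_le (C := ε / 2 * r) hR
    (f := fun ζ : ℂ => f (w + ζ • v) - f (x + ζ • v)) (c := 0)
    (DifferentiableOn.diffContOnCl fun ζ hζ =>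
      (hd ζ (closure_ball_subset_closedBall hζ)).differentiableAt.differentiableWithinAt)
    (fun ζ hζ => by
      have hζ' := sphere_subset_closedBall hζ
      rw [← dist_eq_norm]
      refine hfδ _ (hmem w hwr ζ hζ') _ (hmem x hxr ζ hζ') ?_
      simpa using hwδ.le)
  rw [(hd 0 (mem_closedBall_self hR.le)).deriv] at key
  simp only [zero_smul, add_zero] at key
  calc ‖(fderiv ℂ f w - fderiv ℂ f x) v‖ ≤ ε / 2 * r / (r / ‖v‖) := by simpa using key
    _ = ε / 2 * ‖v‖ := by field_simp

theorem contDiffAt_one_of_differentiableOn_complex {E G : Type*}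
    [NormedAddCommGroup E] [NormedSpace ℂ E] [ProperSpace E]
    [NormedAddCommGroup G] [NormedSpace ℂ G] {f : E → G} {U : Set E}
    (hU : IsOpen U) (hf : DifferentiableOn ℂ f U) {x : E} (hx : x ∈ U) :
    ContDiffAt ℂ 1 f x :=
  contDiffAt_one_iff.2 ⟨fderiv ℂ f, U, hU.mem_nhds hx, continuousOn_fderiv_of_differentiableOn_complex hU hf,
    fun _ hy => (hf.differentiableAt (hU.mem_nhds hy)).hasFDerivAt⟩

/-- The cone over an open subset `V` of an affine hyperplane `ℓ = 1`. -/
theorem isOpen_cone {E : Type*} [NormedAddCommGroup E] [NormedSpace ℂ E] (l : E →L[ℂ] ℂ)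
    {V : Set E} (hV : IsOpen V) : IsOpen {X : E | l X ≠ 0 ∧ (l X)⁻¹ • X ∈ V} := by
  have hc : ContinuousOn (fun X : E => (l X)⁻¹ • X) {X : E | l X ≠ 0} :=
    (l.continuous.continuousOn.inv₀ fun _ h => h).smul continuousOn_id
  exact hc.isOpen_inter_preimage (isOpen_ne_fun l.continuous continuous_const) hV

/-- Extending a holomorphic function to a cone, homogeneously of degree two. -/
theorem differentiableOn_homogeneous_extension {E : Type*} [NormedAddCommGroup E]
    [NormedSpace ℂ E] (l : E →L[ℂ] ℂ) {V : Set E} {h : E → ℂ} (hh : DifferentiableOn ℂ h V) :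
    DifferentiableOn ℂ (fun X => l X ^ 2 * h ((l X)⁻¹ • X))
      {X : E | l X ≠ 0 ∧ (l X)⁻¹ • X ∈ V} := by
  have hl : DifferentiableOn ℂ l {X : E | l X ≠ 0 ∧ (l X)⁻¹ • X ∈ V} := l.differentiableOn
  refine (hl.pow 2).mul (hh.comp ((hl.inv fun _ hX => hX.1).smul differentiableOn_id) ?_)
  exact fun _ hX => hX.2

theorem homogeneous_extension_smul {E : Type*} [NormedAddCommGroup E] [NormedSpace ℂ E]
    (l : E →L[ℂ] ℂ) (h : E → ℂ) {c : ℂ} (hc : c ≠ 0) (X : E) :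
    l (c • X) ^ 2 * h ((l (c • X))⁻¹ • c • X) = c ^ 2 * (l X ^ 2 * h ((l X)⁻¹ • X)) := by
  have : (l (c • X))⁻¹ • c • X = (l X)⁻¹ • X := by
    rw [map_smul, smul_eq_mul, smul_smul, _root_.mul_inv_rev, mul_assoc, inv_mul_cancel₀ hc, mul_one]
  rw [this, map_smul, smul_eq_mul]
  ring

theorem hasFDerivAt_snd_comp_smul {E G : Type*} [NormedAddCommGroup E] [NormedSpace ℂ E]
    [NormedAddCommGroup G] [NormedSpace ℂ G] {f : E → G} {t : ℂ} {z : E}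
    (hf : DifferentiableAt ℂ f z) :
    HasFDerivAt (fun p : ℂ × E => p.1 • f p.2)
      (t • (fderiv ℂ f z).comp (ContinuousLinearMap.snd ℂ ℂ E) +
        (ContinuousLinearMap.fst ℂ ℂ E).smulRight (f z)) (t, z) :=
  hasFDerivAt_fst.smul
    (hf.hasFDerivAt.comp (𝕜 := ℂ) (f := Prod.snd) (t, z) hasFDerivAt_snd)

/-- The prepotential in the coordinates `(t, z) ↦ t Z(z)`. -/
noncomputable def prepotentialPullback {E ι : Type*} [Fintype ι] (Z F : E → ι → ℂ)
    (p : ℂ × E) : ℂ :=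
  p.1 ^ 2 * (2⁻¹ * ∑ I, Z p.2 I * F p.2 I)

theorem hasFDerivAt_sum_mul {E ι : Type*} [NormedAddCommGroup E] [NormedSpace ℂ E] [Fintype ι]
    {Z F : E → ι → ℂ} {z : E} (hZ : DifferentiableAt ℂ Z z) (hF : DifferentiableAt ℂ F z) :
    HasFDerivAt (fun z => ∑ I, Z z I * F z I)
      (∑ I, (Z z I • (ContinuousLinearMap.proj I).comp (fderiv ℂ F z) +
        F z I • (ContinuousLinearMap.proj I).comp (fderiv ℂ Z z))) z :=
  HasFDerivAt.fun_sum fun I _ =>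
    (hasFDerivAt_pi'.1 hZ.hasFDerivAt I).mul (hasFDerivAt_pi'.1 hF.hasFDerivAt I)

/-- If `⟨v, dv⟩ = 0` at `z`, the differential of `prepotentialPullback Z F` at `(1, z)` is
`∑ I, F_I dX^I` pulled back along `(t, z) ↦ t Z(z)`. -/
theorem hasFDerivAt_prepotentialPullback {E ι : Type*} [NormedAddCommGroup E] [NormedSpace ℂ E]
    [Fintype ι] {Z F : E → ι → ℂ} {z : E} (hZ : DifferentiableAt ℂ Z z)
    (hF : DifferentiableAt ℂ F z)
    (hv : ∀ w, ∑ I, (Z z I * fderiv ℂ F z w I - F z I * fderiv ℂ Z z w I) = 0) :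
    HasFDerivAt (prepotentialPullback Z F)
      ((∑ I, F z I • ContinuousLinearMap.proj (R := ℂ) (φ := fun _ : ι => ℂ) I).comp
        (fderiv ℂ (fun p : ℂ × E => p.1 • Z p.2) (1, z))) (1, z) := by
  have h1 := ((hasFDerivAt_sum_mul hZ hF).comp (𝕜 := ℂ) (f := Prod.snd) ((1 : ℂ), z)
    hasFDerivAt_snd).const_mul (2⁻¹ : ℂ)
  have h2 := ((hasFDerivAt_fst (𝕜 := ℂ) (E := ℂ) (F := E) (p := (1, z))).pow 2).mul h1
  refine h2.congr_fderiv ?_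
  rw [(hasFDerivAt_snd_comp_smul hZ).fderiv]
  refine ContinuousLinearMap.ext fun p => ?_
  have hp := hv p.2
  rw [Finset.sum_sub_distrib] at hp
  have hc : ∑ I, F z I * Z z I = ∑ I, Z z I * F z I := by simp only [mul_comm]
  simp [Finset.sum_add_distrib, hc]
  linear_combination 2⁻¹ * hp

open Filter Topology in
theorem ContDiffAt.exists_eventually_comp_eq {E G H : Type*} [NormedAddCommGroup E]
    [NormedSpace ℂ E] [CompleteSpace E] [NormedAddCommGroup G] [NormedSpace ℂ G]
    [NormedAddCommGroup H] [NormedSpace ℂ H] {f : E → G} {k : E → H} {a : E} {e : E ≃L[ℂ] G}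
    (hf : ContDiffAt ℂ 1 f a) (hfe : HasFDerivAt f (e : E →L[ℂ] G) a) (hk : ContDiffAt ℂ 1 k a) :
    ∃ h : G → H, ContDiffAt ℂ 1 h (f a) ∧ ∀ᶠ p in 𝓝 a, h (f p) = k p := by
  have ha : hf.localInverse hfe one_ne_zero (f a) = a := hf.localInverse_apply_image hfe one_ne_zero
  refine ⟨k ∘ hf.localInverse hfe one_ne_zero,
    ContDiffAt.comp _ (ha.symm ▸ hk) (hf.to_localInverse hfe one_ne_zero), ?_⟩
  filter_upwards [(hf.hasStrictFDerivAt' hfe one_ne_zero).eventually_left_inverse] with p hp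
  exact congrArg k hp

open Filter Topology in
theorem ContDiffAt.eventually_surjective_fderiv {E G : Type*} [NormedAddCommGroup E]
    [NormedSpace ℂ E] [CompleteSpace E] [NormedAddCommGroup G] [NormedSpace ℂ G]
    {f : E → G} {a : E} {e : E ≃L[ℂ] G}
    (hf : ContDiffAt ℂ 1 f a) (hfe : HasFDerivAt f (e : E →L[ℂ] G) a) :
    ∀ᶠ p in 𝓝 a, Function.Surjective (fderiv ℂ f p) := by
  have hc : ContinuousAt (fderiv ℂ f) a :=
    (hf.fderiv_right (m := 0) (by simp)).continuousAt
  filter_upwards [hc.eventually (hfe.fderiv ▸ ContinuousLinearEquiv.nhds e)] with p ⟨e', he'⟩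
  rw [← he']
  exact e'.surjective

open Filter Topology in
/-- Coordinate-free form: if `⟨v, dv⟩ = 0` and `(t, z) ↦ t Z(z)` is a local biholomorphism
at `(1, z₀)`, then a prepotential, homogeneous of degree two, exists near `z₀`. -/
theorem exists_local_prepotential {E ι : Type*} [NormedAddCommGroup E] [NormedSpace ℂ E]
    [FiniteDimensional ℂ E] [Fintype ι] [DecidableEq ι] {U : Set E} (hU : IsOpen U)
    {Z F : E → ι → ℂ} (hZ : DifferentiableOn ℂ Z U) (hF : DifferentiableOn ℂ F U)
    (hv : ∀ z ∈ U, ∀ w, ∑ I, (Z z I * fderiv ℂ F z w I - F z I * fderiv ℂ Z z w I) = 0)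
    {z₀ : E} (hz₀ : z₀ ∈ U) (e : (ℂ × E) ≃L[ℂ] (ι → ℂ))
    (hfd : HasFDerivAt (fun p : ℂ × E => p.1 • Z p.2) (e : ℂ × E →L[ℂ] (ι → ℂ)) (1, z₀)) :
    ∃ U₀ : Set E, IsOpen U₀ ∧ z₀ ∈ U₀ ∧ U₀ ⊆ U ∧
      ∃ W : Set (ι → ℂ), IsOpen W ∧ Z '' U₀ ⊆ W ∧
        ∃ P : (ι → ℂ) → ℂ, DifferentiableOn ℂ P W ∧
          (∀ X ∈ W, ∀ c : ℂ, c • X ∈ W → P (c • X) = c ^ 2 * P X) ∧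
          ∀ z ∈ U₀, ∀ I, F z I = fderiv ℂ P (Z z) (Pi.single I 1) := by
  have : ProperSpace E := FiniteDimensional.proper ℂ E
  have hcdZ := contDiffAt_one_of_differentiableOn_complex hU hZ hz₀
  have hcdF := contDiffAt_one_of_differentiableOn_complex hU hF hz₀
  set Φ : ℂ × E → (ι → ℂ) := fun p => p.1 • Z p.2 with hΦ
  have hcdΦ : ContDiffAt ℂ 1 Φ (1, z₀) :=
    contDiffAt_fst.smul (hcdZ.comp (f := Prod.snd) (1, z₀) contDiffAt_snd)
  have hcdK : ContDiffAt ℂ 1 (prepotentialPullback Z F) (1, z₀) := by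
    have h1 := (contDiffAt_pi.1 hcdZ)
    have h2 := (contDiffAt_pi.1 hcdF)
    refine (contDiffAt_fst.pow 2).mul (contDiffAt_const.mul (ContDiffAt.sum fun I _ => ?_))
    exact ((h1 I).comp (f := Prod.snd) (1, z₀) contDiffAt_snd).mul
      ((h2 I).comp (f := Prod.snd) (1, z₀) contDiffAt_snd)
  have hΦ₀ : Φ (1, z₀) = Z z₀ := one_smul _ _
  obtain ⟨h, hcdh, hleft⟩ := hcdΦ.exists_eventually_comp_eq hfd hcdK
  rw [hΦ₀] at hcdh
  have hsurj := hcdΦ.eventually_surjective_fderiv hfd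
  obtain ⟨V, hVd, hVo, hV₀⟩ := eventually_nhds_iff.1
    ((hcdh.eventually (by simp)).mono fun _ hy => hy.differentiableAt one_ne_zero)
  obtain ⟨l, hl⟩ : ∃ l : (ι → ℂ) →L[ℂ] ℂ, l (Z z₀) = 1 := by
    refine SeparatingDual.exists_eq_one fun h0 => ?_
    have hdΦ := hasFDerivAt_snd_comp_smul (t := 1) (hZ.differentiableAt (hU.mem_nhds hz₀))
    have := congrArg (fun L : ℂ × E →L[ℂ] (ι → ℂ) => L (1, 0)) (hfd.unique hdΦ)
    simp [h0] at this
  have hlZ : ContinuousAt (fun z => l (Z z)) z₀ := l.continuous.continuousAt.comp hcdZ.continuousAt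
  have hlne : ∀ᶠ z in 𝓝 z₀, l (Z z) ≠ 0 := hlZ.eventually_ne (by simp [hl])
  have hpair : Tendsto (fun z => ((l (Z z))⁻¹, z)) (𝓝 z₀) (𝓝 (1, z₀)) := by
    have h1 : Tendsto (fun z => (l (Z z))⁻¹) (𝓝 z₀) (𝓝 1) := by
      simpa [hl] using Tendsto.inv₀ hlZ (by simp [hl])
    exact h1.prodMk_nhds tendsto_id
  have hVev : ∀ᶠ z in 𝓝 z₀, (l (Z z))⁻¹ • Z z ∈ V := by
    have : Tendsto Φ (𝓝 (1, z₀)) (𝓝 (Z z₀)) := by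
      simpa only [ContinuousAt, hΦ₀] using hcdΦ.continuousAt
    exact (this.comp hpair).eventually (hVo.mem_nhds hV₀)
  have hone : Tendsto (fun z => ((1 : ℂ), z)) (𝓝 z₀) (𝓝 (1, z₀)) :=
    tendsto_const_nhds.prodMk_nhds tendsto_id
  obtain ⟨U₀, hU₀, hU₀o, hz₀U₀⟩ := eventually_nhds_iff.1 ((hU.eventually_mem hz₀).and
    (hlne.and (hVev.and ((hpair.eventually hleft).and (hone.eventually hsurj)))))
  refine ⟨U₀, hU₀o, hz₀U₀, fun z hz => (hU₀ z hz).1, {X | l X ≠ 0 ∧ (l X)⁻¹ • X ∈ V},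
    isOpen_cone l hVo, ?_, fun X => l X ^ 2 * h ((l X)⁻¹ • X),
    differentiableOn_homogeneous_extension l
      fun y hy => (hVd y hy).differentiableWithinAt, ?_, ?_⟩
  · rintro _ ⟨z, hz, rfl⟩
    exact ⟨(hU₀ z hz).2.1, (hU₀ z hz).2.2.1⟩
  · rintro X - c hc
    refine homogeneous_extension_smul l h ?_ X
    rintro rfl
    simp at hc
  · intro z hz I
    obtain ⟨hzU, hlz, hVz, -, hsz⟩ := hU₀ z hz
    set P : (ι → ℂ) → ℂ := fun X => l X ^ 2 * h ((l X)⁻¹ • X) with hP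
    have hZz := hZ.differentiableAt (hU.mem_nhds hzU)
    have hPd : DifferentiableAt ℂ P (Z z) :=
      (differentiableOn_homogeneous_extension l
        fun y hy => (hVd y hy).differentiableWithinAt).differentiableAt
        ((isOpen_cone l hVo).mem_nhds ⟨hlz, hVz⟩)
    have hPΦ : P ∘ Φ =ᶠ[𝓝 (1, z)] prepotentialPullback Z F := by
      have hn : {p : ℂ × E | p.1 ≠ 0 ∧ p.2 ∈ U₀} ∈ 𝓝 ((1 : ℂ), z) :=
        (continuous_fst.continuousAt.eventually_ne one_ne_zero).and
          (continuous_snd.continuousAt.eventually (hU₀o.mem_nhds hz))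
      filter_upwards [hn] with p ⟨hp1, hp2⟩
      obtain ⟨-, hlp, -, hKp, -⟩ := hU₀ p.2 hp2
      have := homogeneous_extension_smul l h hp1 (Z p.2)
      simp only [hP, Function.comp, hΦ]
      rw [this]
      simp only [hΦ, prepotentialPullback] at hKp ⊢
      rw [hKp]
      field_simp
    have hΦz : HasFDerivAt Φ (fderiv ℂ Φ (1, z)) (1, z) :=
      (hasFDerivAt_snd_comp_smul hZz).differentiableAt.hasFDerivAt
    have hΦ1 : Φ (1, z) = Z z := one_smul _ _
    have hcomp := HasFDerivAt.comp (g := P) (f := Φ) (1, z) (by rw [hΦ1]; exact hPd.hasFDerivAt) hΦz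
    have heq := hcomp.unique ((hasFDerivAt_prepotentialPullback hZz
      (hF.differentiableAt (hU.mem_nhds hzU)) (hv z hzU)).congr_of_eventuallyEq hPΦ)
    obtain ⟨p, hp⟩ := hsz (Pi.single I 1)
    have := congrArg (fun L : ℂ × E →L[ℂ] ℂ => L p) heq
    simp only [ContinuousLinearMap.comp_apply] at this
    rw [hp] at this
    rw [this]
    simp [Pi.single_apply]

theorem ContinuousLinearMap.apply_eq_sum_smul_single {ι G : Type*} [Fintype ι] [DecidableEq ι]
    [NormedAddCommGroup G] [NormedSpace ℂ G] (L : (ι → ℂ) →L[ℂ] G) (w : ι → ℂ) :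
    L w = ∑ i, w i • L (Pi.single i 1) := by
  conv_lhs => rw [← Finset.univ_sum_single w, map_sum]
  refine Finset.sum_congr rfl fun i _ => ?_
  rw [← map_smul, ← Pi.single_smul, smul_eq_mul, mul_one]

/-- Let `v = (Z, F) : U → ℂ^{n+1} × ℂ^{n+1}` be a holomorphic section
satisfying `⟨v, ∂_α v⟩ = 0` and `⟨∂_α v, ∂_β v⟩ = 0` (symplectic pairing
`⟨(Z,F),(W,G)⟩ = Σ_I (Z^I G_I − F_I W^I)`).  If at `z₀ ∈ U` the matrix with columns
`Z(z₀), ∂_1 Z(z₀), …, ∂_n Z(z₀)` is invertible, then near `z₀` there exists a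
holomorphic prepotential `𝔉`, homogeneous of degree two, with `F_I = (∂𝔉/∂X^I) ∘ Z`. -/
theorem local_special_kahler_prepotential_of_invertible (n : ℕ) (hn : 1 ≤ n)
    (U : Set (Fin n → ℂ)) (hU : IsOpen U)
    (Z F : (Fin n → ℂ) → (Fin (n + 1) → ℂ))
    (hZ : DifferentiableOn ℂ Z U) (hF : DifferentiableOn ℂ F U)
    (hvdv : ∀ z ∈ U, ∀ α : Fin n,
      ∑ I : Fin (n + 1), (Z z I * fderiv ℂ F z (Pi.single α 1) I
        - F z I * fderiv ℂ Z z (Pi.single α 1) I) = 0)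
    (hdvdv : ∀ z ∈ U, ∀ α β : Fin n,
      ∑ I : Fin (n + 1), (fderiv ℂ Z z (Pi.single α 1) I * fderiv ℂ F z (Pi.single β 1) I
        - fderiv ℂ F z (Pi.single α 1) I * fderiv ℂ Z z (Pi.single β 1) I) = 0)
    (z₀ : Fin n → ℂ) (hz₀ : z₀ ∈ U)
    (hinv : IsUnit (Matrix.of fun I j =>
      Fin.cases (Z z₀ I) (fun α : Fin n => fderiv ℂ Z z₀ (Pi.single α 1) I) j :
        Matrix (Fin (n + 1)) (Fin (n + 1)) ℂ)) :
    ∃ U₀ : Set (Fin n → ℂ), IsOpen U₀ ∧ z₀ ∈ U₀ ∧ U₀ ⊆ U ∧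
      ∃ W : Set (Fin (n + 1) → ℂ), IsOpen W ∧ Z '' U₀ ⊆ W ∧
        ∃ 𝔉 : (Fin (n + 1) → ℂ) → ℂ, DifferentiableOn ℂ 𝔉 W ∧
          (∀ X ∈ W, ∀ lam : ℂ, lam • X ∈ W → 𝔉 (lam • X) = lam ^ 2 * 𝔉 X) ∧
          ∀ z ∈ U₀, ∀ I : Fin (n + 1), F z I = fderiv ℂ 𝔉 (Z z) (Pi.single I 1) := by
  have hdΦ := hasFDerivAt_snd_comp_smul (t := 1) (hZ.differentiableAt (hU.mem_nhds hz₀))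
  have hinj : Function.Injective (fderiv ℂ (fun p : ℂ × (Fin n → ℂ) => p.1 • Z p.2) (1, z₀)) := by
    rw [hdΦ.fderiv, injective_iff_map_eq_zero]
    rintro ⟨s, w⟩ hsw
    have h := (Matrix.mulVec_injective_iff_isUnit.2 hinv)
    have h0 := @h (Fin.cons s w) 0 (by
      rw [Matrix.mulVec_zero, ← hsw]
      ext I
      simp [Matrix.mulVec, dotProduct, Fin.sum_univ_succ,
        (fderiv ℂ Z z₀).apply_eq_sum_smul_single w, mul_comm, add_comm])
    refine Prod.ext (by simpa using congrFun h0 0) ?_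
    ext α
    simpa using congrFun h0 α.succ
  obtain ⟨e, he⟩ : ∃ e : (ℂ × (Fin n → ℂ)) ≃L[ℂ] (Fin (n + 1) → ℂ),
      (e : _ →L[ℂ] _) = fderiv ℂ (fun p : ℂ × (Fin n → ℂ) => p.1 • Z p.2) (1, z₀) := by
    refine ⟨(LinearEquiv.ofInjectiveOfFinrankEq (fderiv ℂ (fun p : ℂ × (Fin n → ℂ) => p.1 • Z p.2) (1, z₀) : _ →ₗ[ℂ] _) hinj
      (by simp [add_comm])).toContinuousLinearEquiv, ?_⟩
    ext <;> rfl
  refine exists_local_prepotential hU hZ hF (fun z hz w => ?_) hz₀ e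
    (he ▸ hdΦ.differentiableAt.hasFDerivAt)
  simp only [(fderiv ℂ Z z).apply_eq_sum_smul_single w, (fderiv ℂ F z).apply_eq_sum_smul_single w,
    Finset.sum_apply, Pi.smul_apply, smul_eq_mul, Finset.mul_sum, ← Finset.sum_sub_distrib]
  rw [Finset.sum_comm]
  refine Finset.sum_eq_zero fun α _ => ?_
  rw [← mul_zero (w α), ← hvdv z hz α, Finset.mul_sum]
  exact Finset.sum_congr rfl fun I _ => by ring
end

section
/- Let n ≥ 1, let U ⊆ ℂⁿ be open, and let v = (Z, F) : U → ℂ^{n+1} × ℂ^{n+1} be holomorphic with −i⟨v(z), conj v(z)⟩ > 0 for all z ∈ U, satisfying for all z ∈ U and all α, β the constraints ⟨v(z), ∂_α v(z)⟩ = 0 and ⟨∂_α v(z), ∂_β v(z)⟩ = 0. Let z₀ ∈ U and suppose the Hermitian metric g(z₀), with entries g_{αβ̄} = ∂²K/∂z^α ∂z̄^β evaluated at z₀ for K := −log(−i⟨v, conj v⟩), is positive definite. Then the (n+1)×(n+1) matrix whose first column is Z(z₀) and whose (1+α)-th column (α = 1, …, n) is conj(∂_α Z(z₀)) + c_α ·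 conj(Z(z₀)), where c_α := −⟨v(z₀), conj(∂_α v(z₀))⟩ / ⟨v(z₀), conj v(z₀)⟩, is invertible. -/
open Matrix
open scoped ComplexOrder

/-- The holomorphic Wirtinger derivative `∂f/∂z^α = ½(∂f/∂x^α − i ∂f/∂y^α)` of a
real-differentiable function `f : ℂⁿ → ℂ`. -/
noncomputable def wirtingerD {n : ℕ} (f : (Fin n → ℂ) → ℂ) (α : Fin n) (z : Fin n → ℂ) : ℂ :=
  (1 / 2 : ℂ) * (fderiv ℝ f z (Pi.single α 1) - Complex.I * fderiv ℝ f z (Pi.single α Complex.I))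

/-- The antiholomorphic Wirtinger derivative `∂f/∂z̄^α = ½(∂f/∂x^α + i ∂f/∂y^α)`. -/
noncomputable def wirtingerDBar {n : ℕ} (f : (Fin n → ℂ) → ℂ) (α : Fin n) (z : Fin n → ℂ) : ℂ :=
  (1 / 2 : ℂ) * (fderiv ℝ f z (Pi.single α 1) + Complex.I * fderiv ℝ f z (Pi.single α Complex.I))

open Metric Set MeasureTheory in
/-- A directional derivative of a holomorphic map of several variables is holomorphic. -/
theorem differentiableAt_fderiv_apply_of_differentiableOn {E G : Type*}
    [NormedAddCommGroup E] [NormedSpace ℂ E] [FiniteDimensional ℂ E]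
    [NormedAddCommGroup G] [NormedSpace ℂ G] [FiniteDimensional ℂ G]
    {f : E → G} {U : Set E} (hU : IsOpen U) (hf : DifferentiableOn ℂ f U)
    {z₀ : E} (hz₀ : z₀ ∈ U) (v : E) :
    DifferentiableAt ℂ (fun z => fderiv ℂ f z v) z₀ := by
  have : CompleteSpace G := FiniteDimensional.complete ℂ G
  obtain ⟨ε, hε, hball⟩ : ∃ ε > 0, ball z₀ ε ⊆ U ∩ f ⁻¹' ball (f z₀) 1 :=
    mem_nhds_iff.1 <| Filter.inter_mem (hU.mem_nhds hz₀)
      ((hf.continuousOn.continuousAt (hU.mem_nhds hz₀)).preimage_mem_nhds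
        (ball_mem_nhds _ one_pos))
  set r : ℝ := ε / 3 with hr_def
  have hr : 0 < r := by positivity
  set ρ : ℝ := r / (‖v‖ + 1) with hρ_def
  have hρ : 0 < ρ := by positivity
  have hρv : ρ * ‖v‖ < r := by
    rw [hρ_def, div_mul_eq_mul_div, div_lt_iff₀ (by positivity)]
    nlinarith [norm_nonneg v]
  have hbound : ∀ z ∈ ball z₀ (2 * r), ‖fderiv ℂ f z‖ ≤ 2 / r := by
    intro z hz
    have hsub : ball z r ⊆ ball z₀ ε := ball_subset_ball' (by
      rw [mem_ball] at hz; linarith)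
    refine Complex.norm_fderiv_le_div_of_mapsTo_ball
      (hf.mono fun w hw => (hball (hsub hw)).1) (fun w hw => ?_) hr
    have h1 := (hball (hsub hw)).2
    have h2 := (hball (hsub (mem_ball_self hr))).2
    rw [mem_preimage, mem_ball] at h1 h2
    rw [mem_closedBall]
    linarith [dist_triangle_right (f w) (f z) (f z₀)]
  have hshift : ∀ x ∈ ball z₀ r, ∀ t ∈ closedBall (0 : ℂ) ρ, x + t • v ∈ ball z₀ (2 * r) := by
    intro x hx t ht
    rw [mem_ball, dist_eq_norm] at hx ⊢
    rw [mem_closedBall, dist_zero_right] at ht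
    calc ‖x + t • v - z₀‖ = ‖(x - z₀) + t • v‖ := by congr 1; abel
      _ ≤ ‖x - z₀‖ + ‖t‖ * ‖v‖ := (norm_add_le _ _).trans_eq (by rw [norm_smul])
      _ < 2 * r := by nlinarith [mul_le_mul_of_nonneg_right ht (norm_nonneg v)]
  have h2r : ball z₀ (2 * r) ⊆ U := fun w hw =>
    (hball (ball_subset_ball (by linarith) hw)).1
  have hdiff : ∀ x ∈ ball z₀ (2 * r), DifferentiableAt ℂ f x := fun x hx =>
    hf.differentiableAt (hU.mem_nhds (h2r hx))
  have hcircle : ∀ θ : ℝ, circleMap 0 ρ θ ∈ closedBall (0 : ℂ) ρ := fun θ =>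
    circleMap_mem_closedBall 0 hρ.le θ
  set k : ℝ → ℂ := fun θ => deriv (circleMap 0 ρ) θ * ((circleMap 0 ρ θ - 0) ^ 2)⁻¹ with hk
  have hk_cont : Continuous k := by
    have hne : ∀ θ : ℝ, (circleMap 0 ρ θ - 0) ^ 2 ≠ 0 := fun θ => by
      simpa using hρ.ne'
    simp only [hk, deriv_circleMap]
    exact ((continuous_circleMap 0 ρ).mul continuous_const).mul
      ((((continuous_circleMap 0 ρ).sub continuous_const).pow 2).inv₀ hne)
  have hcauchy : ∀ z ∈ ball z₀ r, (2 * Real.pi * Complex.I : ℂ)⁻¹ •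
      (∫ θ in (0 : ℝ)..2 * Real.pi, k θ • f (z + circleMap 0 ρ θ • v)) = fderiv ℂ f z v := by
    intro z hz
    have hline : ∀ t : ℂ, HasDerivAt (fun t : ℂ => z + t • v) v t := fun t => by
      simpa using ((hasDerivAt_id t).smul_const v).const_add z
    have hV : IsOpen ((fun t : ℂ => z + t • v) ⁻¹' ball z₀ (2 * r)) :=
      isOpen_ball.preimage (by fun_prop)
    have h := Complex.cderiv_eq_deriv (f := fun t : ℂ => f (z + t • v)) (z := 0) hV
      (fun t ht => ((hdiff _ ht).comp t (hline t).differentiableAt).differentiableWithinAt)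
      hρ (hshift z hz)
    have hd : deriv (fun t : ℂ => f (z + t • v)) 0 = fderiv ℂ f z v := by
      have hz' : DifferentiableAt ℂ f (z + (0 : ℂ) • v) :=
        hdiff _ (hshift z hz 0 (mem_closedBall_self hρ.le))
      have := (hz'.hasFDerivAt.comp_hasDerivAt (0 : ℂ) (hline 0)).deriv
      simpa [Function.comp_def] using this
    rw [← hd, ← h, Complex.cderiv, circleIntegral]
    simp only [hk, smul_smul]
  have hcont : ∀ x ∈ ball z₀ r, Continuous fun θ : ℝ => k θ • f (x + circleMap 0 ρ θ • v) := by
    intro x hx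
    refine hk_cont.smul (continuous_iff_continuousAt.2 fun θ => ?_)
    exact (hdiff _ (hshift x hx _ (hcircle θ))).continuousAt.comp
      (f := fun θ : ℝ => x + circleMap 0 ρ θ • v)
      (continuous_const.add ((continuous_circleMap 0 ρ).smul continuous_const)).continuousAt
  have hmeas : AEStronglyMeasurable
      (fun θ : ℝ => k θ • fderiv ℂ f (z₀ + circleMap 0 ρ θ • v))
      (volume.restrict (uIoc 0 (2 * Real.pi))) := by
    borelize E
    borelize (E →L[ℂ] G)
    have : ProperSpace (E →L[ℂ] G) := FiniteDimensional.proper ℂ _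
    refine (hk_cont.measurable.aestronglyMeasurable).smul
      (Measurable.aestronglyMeasurable ?_)
    exact (measurable_fderiv ℂ f).comp
      (continuous_const.add ((continuous_circleMap 0 ρ).smul continuous_const)).measurable
  have hmain := intervalIntegral.hasFDerivAt_integral_of_dominated_of_fderiv_le
    (𝕜 := ℂ) (μ := volume) (a := 0) (b := 2 * Real.pi) (x₀ := z₀) (s := ball z₀ r)
    (F := fun x θ => k θ • f (x + circleMap 0 ρ θ • v))
    (F' := fun x θ => k θ • fderiv ℂ f (x + circleMap 0 ρ θ • v))
    (bound := fun θ => ‖k θ‖ * (2 / r)) (ball_mem_nhds _ hr)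
    (Filter.eventually_of_mem (ball_mem_nhds _ hr) fun x hx =>
      (hcont x hx).aestronglyMeasurable)
    ((hcont z₀ (mem_ball_self hr)).intervalIntegrable _ _) hmeas
    (Filter.Eventually.of_forall fun θ _ x hx => by
      rw [norm_smul]
      exact mul_le_mul_of_nonneg_left (hbound _ (hshift x hx _ (hcircle θ))) (norm_nonneg _))
    ((hk_cont.norm.mul continuous_const).intervalIntegrable _ _)
    (Filter.Eventually.of_forall fun θ _ x hx =>
      ((hdiff _ (hshift x hx _ (hcircle θ))).hasFDerivAt.comp x
        ((hasFDerivAt_id x).add_const _)).const_smul (k θ))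
  refine (hmain.differentiableAt.const_smul (2 * Real.pi * Complex.I : ℂ)⁻¹).congr_of_eventuallyEq
    (Filter.eventually_of_mem (ball_mem_nhds _ hr) fun z hz => (hcauchy z hz).symm)

section Wirtinger

variable {n : ℕ} {f g : (Fin n → ℂ) → ℂ} {z : Fin n → ℂ}

theorem HasFDerivAt.wirtingerD {L : (Fin n → ℂ) →L[ℝ] ℂ} (h : HasFDerivAt f L z) (α : Fin n) :
    wirtingerD f α z =
      (1 / 2 : ℂ) * (L (Pi.single α 1) - Complex.I * L (Pi.single α Complex.I)) := by
  rw [_root_.wirtingerD, h.fderiv]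

theorem HasFDerivAt.wirtingerDBar {L : (Fin n → ℂ) →L[ℝ] ℂ} (h : HasFDerivAt f L z) (α : Fin n) :
    wirtingerDBar f α z =
      (1 / 2 : ℂ) * (L (Pi.single α 1) + Complex.I * L (Pi.single α Complex.I)) := by
  rw [_root_.wirtingerDBar, h.fderiv]

theorem Filter.EventuallyEq.wirtingerD_eq (h : f =ᶠ[nhds z] g) (α : Fin n) :
    wirtingerD f α z = wirtingerD g α z := by
  rw [wirtingerD, wirtingerD, h.fderiv_eq]

theorem wirtingerD_neg (α : Fin n) :
    wirtingerD (fun z => -f z) α z = -wirtingerD f α z := by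
  simp only [wirtingerD, fderiv_fun_neg, _root_.neg_apply]
  ring

theorem wirtingerD_div (hf : DifferentiableAt ℝ f z) (hg : DifferentiableAt ℝ g z)
    (hz : g z ≠ 0) (α : Fin n) :
    wirtingerD (fun z => f z / g z) α z =
      (wirtingerD f α z * g z - f z * wirtingerD g α z) / g z ^ 2 := by
  have h := (hf.hasFDerivAt.mul (((hasDerivAt_inv hz).hasFDerivAt.restrictScalars ℝ).comp z
    hg.hasFDerivAt)).wirtingerD α
  simp only [Function.comp_def] at h
  refine h.trans ?_
  simp [wirtingerD]
  field_simp
  ring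

/-- The chain rule for the logarithm of a real-differentiable function. -/
theorem wirtingerDBar_neg_log (hf : DifferentiableAt ℝ f z)
    (hz : f z ∈ Complex.slitPlane) (α : Fin n) :
    wirtingerDBar (fun z => -Complex.log (f z)) α z = -(wirtingerDBar f α z / f z) := by
  have h := (((Complex.hasDerivAt_log hz).hasFDerivAt.restrictScalars ℝ).comp z
    hf.hasFDerivAt).neg.wirtingerDBar α
  refine h.trans ?_
  simp [wirtingerDBar]
  ring

theorem wirtingerDBar_const_mul (c : ℂ) (hf : DifferentiableAt ℝ f z) (α : Fin n) :
    wirtingerDBar (fun z => c * f z) α z = c * wirtingerDBar f α z := by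
  rw [(hf.hasFDerivAt.const_mul c).wirtingerDBar α, wirtingerDBar]
  simp
  ring

end Wirtinger

section SympConj

variable {m : Type*} [Fintype m]

/-- The value `⟨v, conj w⟩` of the symplectic product, for `v = (Z, F)` and `w = (W, G)`. -/
noncomputable def sympConj (Z F W G : m → ℂ) : ℂ :=
  ∑ I, (Z I * starRingEnd ℂ (G I) - F I * starRingEnd ℂ (W I))

theorem star_sympConj (Z F W G : m → ℂ) :
    starRingEnd ℂ (sympConj Z F W G) = -sympConj W G Z F := by
  simp only [sympConj, map_sum, map_sub, map_mul, Complex.conj_conj, ← Finset.sum_neg_distrib]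
  exact Finset.sum_congr rfl fun I _ => by ring

theorem sympConj_sum_smul_left {ι : Type*} [Fintype ι] (a : ι → ℂ) (A B : ι → m → ℂ)
    (W G : m → ℂ) :
    sympConj (∑ i, a i • A i) (∑ i, a i • B i) W G = ∑ i, a i * sympConj (A i) (B i) W G := by
  simp only [sympConj, Finset.sum_apply, Pi.smul_apply, smul_eq_mul, Finset.mul_sum,
    Finset.sum_mul, ← Finset.sum_sub_distrib]
  rw [Finset.sum_comm]
  exact Finset.sum_congr rfl fun i _ => Finset.sum_congr rfl fun I _ => by ring

theorem sympConj_sum_smul_right {ι : Type*} [Fintype ι] (a : ι → ℂ) (A B : ι → m → ℂ)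
    (Z F : m → ℂ) :
    sympConj Z F (∑ i, starRingEnd ℂ (a i) • A i) (∑ i, starRingEnd ℂ (a i) • B i) =
      ∑ i, a i * sympConj Z F (A i) (B i) := by
  simp only [sympConj, Finset.sum_apply, Pi.smul_apply, smul_eq_mul, Finset.mul_sum, map_sum,
    map_mul, Complex.conj_conj, ← Finset.sum_sub_distrib]
  rw [Finset.sum_comm]
  exact Finset.sum_congr rfl fun i _ => Finset.sum_congr rfl fun I _ => by ring

theorem sympConj_add_smul_left (k : ℂ) (A B C D W G : m → ℂ) :
    sympConj (A + k • C) (B + k • D) W G = sympConj A B W G + k * sympConj C D W G := by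
  simp only [sympConj, Pi.add_apply, Pi.smul_apply, smul_eq_mul, Finset.mul_sum,
    ← Finset.sum_add_distrib]
  exact Finset.sum_congr rfl fun I _ => by ring

theorem sympConj_add_smul_right (k : ℂ) (Z F A B C D : m → ℂ) :
    sympConj Z F (A + k • C) (B + k • D) =
      sympConj Z F A B + starRingEnd ℂ k * sympConj Z F C D := by
  simp only [sympConj, Pi.add_apply, Pi.smul_apply, smul_eq_mul, Finset.mul_sum, map_add, map_mul,
    ← Finset.sum_add_distrib]
  exact Finset.sum_congr rfl fun I _ => by ring

/-- If `⟨v, y⟩ = 0` and the first component of `a • v + conj y` vanishes, then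
`|a|² ⟨v, conj v⟩ = ⟨y, conj y⟩`. -/
theorem normSq_mul_sympConj_of_first_eq_zero {Z F Y X : m → ℂ} {a : ℂ}
    (hortho : ∑ I, (Z I * X I - F I * Y I) = 0)
    (hfirst : ∀ I, a * Z I + starRingEnd ℂ (Y I) = 0) :
    a * starRingEnd ℂ a * sympConj Z F Z F = sympConj Y X Y X := by
  have hZ : ∀ I, a * Z I = -starRingEnd ℂ (Y I) := fun I => eq_neg_of_add_eq_zero_left (hfirst I)
  have hZ' : ∀ I, starRingEnd ℂ a * starRingEnd ℂ (Z I) = -Y I := fun I => by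
    rw [← map_mul, hZ, map_neg, Complex.conj_conj]
  have hortho' : ∑ I, (starRingEnd ℂ (Z I) * starRingEnd ℂ (X I)
      - starRingEnd ℂ (F I) * starRingEnd ℂ (Y I)) = 0 := by
    simpa using congrArg (starRingEnd ℂ) hortho
  have key : a * starRingEnd ℂ a * sympConj Z F Z F - sympConj Y X Y X =
      starRingEnd ℂ a * ∑ I, (starRingEnd ℂ (Z I) * starRingEnd ℂ (X I)
        - starRingEnd ℂ (F I) * starRingEnd ℂ (Y I)) -
      a * ∑ I, (Z I * X I - F I * Y I) := by
    simp only [sympConj, Finset.mul_sum, ← Finset.sum_sub_distrib]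
    refine Finset.sum_congr rfl fun I _ => ?_
    linear_combination (starRingEnd ℂ a * starRingEnd ℂ (F I) + X I) * hZ I
      - (a * F I + starRingEnd ℂ (X I)) * hZ' I
  rw [hortho, hortho', mul_zero, mul_zero, sub_zero] at key
  exact sub_eq_zero.1 key

/-- Gram matrix of the components of `B` orthogonal to `v = (Z, F)`:
for `y = ∑ conj (a i) • (B i - (⟨B i, conj v⟩ / ⟨v, conj v⟩) • v)`, the value `⟨y, conj y⟩`. -/
theorem sympConj_self_projection {ι : Type*} [Fintype ι] {Z F : m → ℂ} {A B : ι → m → ℂ}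
    (hs : sympConj Z F Z F ≠ 0) {c : ι → ℂ}
    (hc : ∀ i, c i = -sympConj Z F (A i) (B i) / sympConj Z F Z F)
    {g : Matrix ι ι ℂ}
    (hg : ∀ i j, g i j = -((sympConj (A i) (B i) (A j) (B j) * sympConj Z F Z F -
      sympConj Z F (A j) (B j) * sympConj (A i) (B i) Z F) / sympConj Z F Z F ^ 2))
    (a : ι → ℂ) {k : ℂ} (hk : k = ∑ i, starRingEnd ℂ (a i) * starRingEnd ℂ (c i)) :
    sympConj (∑ i, starRingEnd ℂ (a i) • A i + k • Z) (∑ i, starRingEnd ℂ (a i) • B i + k • F)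
      (∑ i, starRingEnd ℂ (a i) • A i + k • Z) (∑ i, starRingEnd ℂ (a i) • B i + k • F) =
      -sympConj Z F Z F * (star a ⬝ᵥ (g *ᵥ a)) := by
  have hcc : ∀ i, starRingEnd ℂ (c i) = -sympConj (A i) (B i) Z F / sympConj Z F Z F := fun i => by
    rw [hc, map_div₀, map_neg, star_sympConj, star_sympConj]
    field_simp
  have hyv : sympConj (∑ i, starRingEnd ℂ (a i) • A i + k • Z)
      (∑ i, starRingEnd ℂ (a i) • B i + k • F) Z F = 0 := by
    rw [sympConj_add_smul_left, sympConj_sum_smul_left, hk, Finset.sum_mul,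
      ← Finset.sum_add_distrib]
    refine Finset.sum_eq_zero fun i _ => ?_
    rw [hcc]
    field_simp
    ring
  rw [sympConj_add_smul_right, hyv, mul_zero, add_zero, sympConj_sum_smul_right]
  simp only [sympConj_add_smul_left, sympConj_sum_smul_left, hk, dotProduct, mulVec,
    Finset.mul_sum, Finset.sum_mul, ← Finset.sum_add_distrib, Pi.star_apply]
  rw [Finset.sum_comm]
  refine Finset.sum_congr rfl fun i _ => Finset.sum_congr rfl fun j _ => ?_
  rw [hcc, hg]
  simp only [RCLike.star_def]
  field_simp
  ring

end SympConj

section SympConjDeriv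

variable {n : ℕ} {m : Type*} [Fintype m] {Z F W G : (Fin n → ℂ) → m → ℂ} {z : Fin n → ℂ}

theorem hasFDerivAt_sympConj (hZ : DifferentiableAt ℂ Z z) (hF : DifferentiableAt ℂ F z)
    (hW : DifferentiableAt ℂ W z) (hG : DifferentiableAt ℂ G z) :
    ∃ L : (Fin n → ℂ) →L[ℝ] ℂ,
      HasFDerivAt (fun z => sympConj (Z z) (F z) (W z) (G z)) L z ∧
      ∀ w, L w = sympConj (fderiv ℂ Z z w) (fderiv ℂ F z w) (W z) (G z) +
        sympConj (Z z) (F z) (fderiv ℂ W z w) (fderiv ℂ G z w) := by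
  have hcomp : ∀ {A : (Fin n → ℂ) → m → ℂ}, DifferentiableAt ℂ A z → ∀ I,
      HasFDerivAt (fun z => A z I)
        ((((ContinuousLinearMap.proj I).comp (fderiv ℂ A z)).restrictScalars ℝ :
          (Fin n → ℂ) →L[ℝ] ℂ)) z := fun hA I =>
    (hasFDerivAt_pi'.1 hA.hasFDerivAt I).restrictScalars ℝ
  have hconj : ∀ {A : (Fin n → ℂ) → m → ℂ}, DifferentiableAt ℂ A z → ∀ I,
      HasFDerivAt (fun z => starRingEnd ℂ (A z I))
        ((Complex.conjCLE : ℂ →L[ℝ] ℂ).comp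
          (((ContinuousLinearMap.proj I).comp (fderiv ℂ A z)).restrictScalars ℝ :
          (Fin n → ℂ) →L[ℝ] ℂ)) z := fun hA I =>
    (Complex.conjCLE : ℂ →L[ℝ] ℂ).hasFDerivAt.comp z (hcomp hA I)
  refine ⟨_, HasFDerivAt.fun_sum fun I _ =>
    ((hcomp hZ I).mul (hconj hG I)).sub ((hcomp hF I).mul (hconj hW I)), fun w => ?_⟩
  simp only [sympConj, ← Finset.sum_add_distrib, _root_.sum_apply]
  refine Finset.sum_congr rfl fun I _ => ?_
  simp
  ring

theorem differentiableAt_sympConj (hZ : DifferentiableAt ℂ Z z) (hF : DifferentiableAt ℂ F z)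
    (hW : DifferentiableAt ℂ W z) (hG : DifferentiableAt ℂ G z) :
    DifferentiableAt ℝ (fun z => sympConj (Z z) (F z) (W z) (G z)) z :=
  let ⟨_, hL, _⟩ := hasFDerivAt_sympConj hZ hF hW hG
  hL.differentiableAt

theorem single_I_eq_smul (α : Fin n) :
    (Pi.single α Complex.I : Fin n → ℂ) = Complex.I • Pi.single α 1 := by
  rw [← Pi.single_smul, smul_eq_mul, mul_one]

theorem sympConj_smul_left (k : ℂ) (A B C D : m → ℂ) :
    sympConj (k • A) (k • B) C D = k * sympConj A B C D := by
  simpa [sympConj] using sympConj_add_smul_left k 0 0 A B C D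

theorem sympConj_smul_right (k : ℂ) (A B C D : m → ℂ) :
    sympConj A B (k • C) (k • D) = starRingEnd ℂ k * sympConj A B C D := by
  simpa [sympConj] using sympConj_add_smul_right k A B 0 0 C D

theorem wirtingerD_sympConj (hZ : DifferentiableAt ℂ Z z) (hF : DifferentiableAt ℂ F z)
    (hW : DifferentiableAt ℂ W z) (hG : DifferentiableAt ℂ G z) (α : Fin n) :
    wirtingerD (fun z => sympConj (Z z) (F z) (W z) (G z)) α z =
      sympConj (fderiv ℂ Z z (Pi.single α 1)) (fderiv ℂ F z (Pi.single α 1)) (W z) (G z) := by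
  obtain ⟨L, hL, hLw⟩ := hasFDerivAt_sympConj hZ hF hW hG
  rw [hL.wirtingerD, hLw, hLw, single_I_eq_smul]
  simp only [map_smul, sympConj_smul_left, sympConj_smul_right, Complex.conj_I]
  linear_combination (-1 / 2 * sympConj (fderiv ℂ Z z (Pi.single α 1))
    (fderiv ℂ F z (Pi.single α 1)) (W z) (G z) + 1 / 2 * sympConj (Z z) (F z)
    (fderiv ℂ W z (Pi.single α 1)) (fderiv ℂ G z (Pi.single α 1))) * Complex.I_sq

theorem wirtingerDBar_sympConj (hZ : DifferentiableAt ℂ Z z) (hF : DifferentiableAt ℂ F z)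
    (hW : DifferentiableAt ℂ W z) (hG : DifferentiableAt ℂ G z) (α : Fin n) :
    wirtingerDBar (fun z => sympConj (Z z) (F z) (W z) (G z)) α z =
      sympConj (Z z) (F z) (fderiv ℂ W z (Pi.single α 1)) (fderiv ℂ G z (Pi.single α 1)) := by
  obtain ⟨L, hL, hLw⟩ := hasFDerivAt_sympConj hZ hF hW hG
  rw [hL.wirtingerDBar, hLw, hLw, single_I_eq_smul]
  simp only [map_smul, sympConj_smul_left, sympConj_smul_right, Complex.conj_I]
  linear_combination (1 / 2 * sympConj (fderiv ℂ Z z (Pi.single α 1))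
    (fderiv ℂ F z (Pi.single α 1)) (W z) (G z) - 1 / 2 * sympConj (Z z) (F z)
    (fderiv ℂ W z (Pi.single α 1)) (fderiv ℂ G z (Pi.single α 1))) * Complex.I_sq

end SympConjDeriv

/-- The mixed Wirtinger derivatives of the Kähler potential `-log (-i⟨v, conj v⟩)` of a
holomorphic section `v = (Z, F)`. -/
theorem wirtingerD_wirtingerDBar_kahlerPotential {n : ℕ} {m : Type*} [Fintype m]
    {Z F : (Fin n → ℂ) → m → ℂ} {U : Set (Fin n → ℂ)} (hU : IsOpen U)
    (hZ : DifferentiableOn ℂ Z U) (hF : DifferentiableOn ℂ F U)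
    (hpos : ∀ z ∈ U, 0 < -Complex.I * sympConj (Z z) (F z) (Z z) (F z))
    {z : Fin n → ℂ} (hz : z ∈ U) (α β : Fin n) :
    wirtingerD (wirtingerDBar
        (fun z => -Complex.log (-Complex.I * sympConj (Z z) (F z) (Z z) (F z))) β) α z =
      -((sympConj (fderiv ℂ Z z (Pi.single α 1)) (fderiv ℂ F z (Pi.single α 1))
            (fderiv ℂ Z z (Pi.single β 1)) (fderiv ℂ F z (Pi.single β 1)) *
          sympConj (Z z) (F z) (Z z) (F z) -
        sympConj (Z z) (F z) (fderiv ℂ Z z (Pi.single β 1)) (fderiv ℂ F z (Pi.single β 1)) *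
          sympConj (fderiv ℂ Z z (Pi.single α 1)) (fderiv ℂ F z (Pi.single α 1)) (Z z) (F z)) /
        sympConj (Z z) (F z) (Z z) (F z) ^ 2) := by
  have hdZ : ∀ w ∈ U, DifferentiableAt ℂ Z w := fun w hw => hZ.differentiableAt (hU.mem_nhds hw)
  have hdF : ∀ w ∈ U, DifferentiableAt ℂ F w := fun w hw => hF.differentiableAt (hU.mem_nhds hw)
  have hne : ∀ w ∈ U, sympConj (Z w) (F w) (Z w) (F w) ≠ 0 := fun w hw =>
    right_ne_zero_of_mul (hpos w hw).ne'
  have hfirst : ∀ w ∈ U, wirtingerDBar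
      (fun z => -Complex.log (-Complex.I * sympConj (Z z) (F z) (Z z) (F z))) β w =
      -(sympConj (Z w) (F w) (fderiv ℂ Z w (Pi.single β 1)) (fderiv ℂ F w (Pi.single β 1)) /
        sympConj (Z w) (F w) (Z w) (F w)) := by
    intro w hw
    have hd := differentiableAt_sympConj (hdZ w hw) (hdF w hw) (hdZ w hw) (hdF w hw)
    rw [wirtingerDBar_neg_log (hd.const_mul _)
        (Complex.mem_slitPlane_iff.2 (Or.inl (Complex.pos_iff.1 (hpos w hw)).1)),
      wirtingerDBar_const_mul _ hd,
      wirtingerDBar_sympConj (hdZ w hw) (hdF w hw) (hdZ w hw) (hdF w hw),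
      mul_div_mul_left _ _ (neg_ne_zero.2 Complex.I_ne_zero)]
  have hdZβ := differentiableAt_fderiv_apply_of_differentiableOn hU hZ hz (Pi.single β 1)
  have hdFβ := differentiableAt_fderiv_apply_of_differentiableOn hU hF hz (Pi.single β 1)
  rw [Filter.EventuallyEq.wirtingerD_eq (Filter.eventually_of_mem (hU.mem_nhds hz) hfirst),
    wirtingerD_neg,
    wirtingerD_div (differentiableAt_sympConj (hdZ z hz) (hdF z hz) hdZβ hdFβ)
      (differentiableAt_sympConj (hdZ z hz) (hdF z hz) (hdZ z hz) (hdF z hz)) (hne z hz),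
    wirtingerD_sympConj (hdZ z hz) (hdF z hz) hdZβ hdFβ,
    wirtingerD_sympConj (hdZ z hz) (hdF z hz) (hdZ z hz) (hdF z hz)]


/-- For a holomorphic section `v = (Z,F)` of local special Kähler geometry
(with `−i⟨v, conj v⟩ > 0`, `⟨v, ∂_α v⟩ = 0`, `⟨∂_α v, ∂_β v⟩ = 0`), if the metric
`g_{αβ̄} = ∂²K/∂z^α∂z̄^β` (for `K = −log(−i⟨v, conj v⟩)`) is positive definite at `z₀`,
then the matrix `(Z(z₀) | conj(∂_α Z(z₀)) + c_α conj(Z(z₀)))`, with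
`c_α = −⟨v(z₀), conj(∂_α v(z₀))⟩ / ⟨v(z₀), conj v(z₀)⟩`, is invertible. -/
theorem special_kahler_matrix_isUnit (n : ℕ) (hn : 1 ≤ n)
    (U : Set (Fin n → ℂ)) (hU : IsOpen U)
    (Z F : (Fin n → ℂ) → (Fin (n + 1) → ℂ))
    (hZ : DifferentiableOn ℂ Z U) (hF : DifferentiableOn ℂ F U)
    (hpos : ∀ z ∈ U, 0 < -Complex.I *
      ∑ I : Fin (n + 1), (Z z I * starRingEnd ℂ (F z I) - F z I * starRingEnd ℂ (Z z I)))
    (hvdv : ∀ z ∈ U, ∀ α : Fin n,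
      ∑ I : Fin (n + 1), (Z z I * fderiv ℂ F z (Pi.single α 1) I
        - F z I * fderiv ℂ Z z (Pi.single α 1) I) = 0)
    (hdvdv : ∀ z ∈ U, ∀ α β : Fin n,
      ∑ I : Fin (n + 1), (fderiv ℂ Z z (Pi.single α 1) I * fderiv ℂ F z (Pi.single β 1) I
        - fderiv ℂ F z (Pi.single α 1) I * fderiv ℂ Z z (Pi.single β 1) I) = 0)
    (z₀ : Fin n → ℂ) (hz₀ : z₀ ∈ U)
    (K : (Fin n → ℂ) → ℂ)
    (hK : ∀ z, K z = -Complex.log (-Complex.I *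
      ∑ I : Fin (n + 1), (Z z I * starRingEnd ℂ (F z I) - F z I * starRingEnd ℂ (Z z I))))
    (hg : Matrix.PosDef (Matrix.of fun α β : Fin n =>
      wirtingerD (wirtingerDBar K β) α z₀))
    (c : Fin n → ℂ)
    (hc : ∀ α : Fin n, c α =
      -(∑ I : Fin (n + 1), (Z z₀ I * starRingEnd ℂ (fderiv ℂ F z₀ (Pi.single α 1) I)
          - F z₀ I * starRingEnd ℂ (fderiv ℂ Z z₀ (Pi.single α 1) I))) /
        (∑ I : Fin (n + 1), (Z z₀ I * starRingEnd ℂ (F z₀ I)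
          - F z₀ I * starRingEnd ℂ (Z z₀ I)))) :
    IsUnit (Matrix.of fun I j => Fin.cases (Z z₀ I)
      (fun α : Fin n => starRingEnd ℂ (fderiv ℂ Z z₀ (Pi.single α 1) I)
        + c α * starRingEnd ℂ (Z z₀ I)) j :
      Matrix (Fin (n + 1)) (Fin (n + 1)) ℂ) := by
  have hs : sympConj (Z z₀) (F z₀) (Z z₀) (F z₀) ≠ 0 := right_ne_zero_of_mul (hpos z₀ hz₀).ne'
  obtain rfl : K = fun z => -Complex.log (-Complex.I * sympConj (Z z) (F z) (Z z) (F z)) :=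
    funext hK
  rw [Matrix.isUnit_iff_isUnit_det, isUnit_iff_ne_zero, Ne, ← Matrix.exists_mulVec_eq_zero_iff]
  rintro ⟨a, ha, hMa⟩
  refine ha ?_
  set b : Fin n → ℂ := fun α => a α.succ with hb
  set k : ℂ := ∑ α, starRingEnd ℂ (b α) * starRingEnd ℂ (c α) with hk
  set A : Fin n → Fin (n + 1) → ℂ := fun α => fderiv ℂ Z z₀ (Pi.single α 1) with hA
  set B : Fin n → Fin (n + 1) → ℂ := fun α => fderiv ℂ F z₀ (Pi.single α 1)
  have hfirst : ∀ I, a 0 * Z z₀ I +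
      starRingEnd ℂ ((∑ α, starRingEnd ℂ (b α) • A α + k • Z z₀) I) = 0 := by
    intro I
    have h := congrFun hMa I
    simp only [Matrix.mulVec, dotProduct, Matrix.of_apply, Fin.sum_univ_succ, Fin.cases_zero,
      Fin.cases_succ, Pi.zero_apply] at h
    rw [← h]
    simp only [hk, hA, hb, Pi.add_apply, Finset.sum_apply, Pi.smul_apply, smul_eq_mul, map_add,
      map_sum, map_mul, Complex.conj_conj, Finset.sum_mul, ← Finset.sum_add_distrib]
    rw [mul_comm]
    congr 1
    exact Finset.sum_congr rfl fun α _ => by ring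
  have hortho : ∑ I, (Z z₀ I * (∑ α, starRingEnd ℂ (b α) • B α + k • F z₀) I -
      F z₀ I * (∑ α, starRingEnd ℂ (b α) • A α + k • Z z₀) I) = 0 := by
    calc _ = ∑ α, starRingEnd ℂ (b α) * ∑ I, (Z z₀ I * B α I - F z₀ I * A α I) := by
          simp only [Pi.add_apply, Finset.sum_apply, Pi.smul_apply, smul_eq_mul, Finset.mul_sum]
          rw [Finset.sum_comm]
          refine Finset.sum_congr rfl fun I _ => ?_
          simp only [mul_add, Finset.mul_sum, mul_sub, Finset.sum_sub_distrib]
          simp only [mul_left_comm]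
          ring
      _ = 0 := Finset.sum_eq_zero fun α _ => by rw [hvdv z₀ hz₀ α, mul_zero]
  have hnorm := normSq_mul_sympConj_of_first_eq_zero hortho hfirst
  set g : Matrix (Fin n) (Fin n) ℂ := Matrix.of fun α β => wirtingerD (wirtingerDBar
    (fun z => -Complex.log (-Complex.I * sympConj (Z z) (F z) (Z z) (F z))) β) α z₀
  rw [sympConj_self_projection (g := g) hs hc (fun α β =>
    wirtingerD_wirtingerDBar_kahlerPotential hU hZ hF hpos hz₀ α β) b hk] at hnorm
  have hsum : a 0 * starRingEnd ℂ (a 0) + star b ⬝ᵥ (g *ᵥ b) = 0 := by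
    refine (mul_eq_zero.1 ?_).resolve_right hs
    linear_combination hnorm
  have h0 : 0 ≤ a 0 * starRingEnd ℂ (a 0) := mul_star_self_nonneg (a 0)
  have hb0 : b = 0 := by
    by_contra hne
    exact (add_pos_of_nonneg_of_pos h0 (hg.dotProduct_mulVec_pos hne)).ne' hsum
  have ha0 : a 0 = 0 := by
    rw [hb0] at hsum
    simpa using hsum
  funext j
  exact Fin.cases ha0 (fun α => congrFun hb0 α) j
end

section
/- Let n ≥ 1, let U ⊆ ℂⁿ be open, and let v = (Z, F) : U → ℂ^{n+1} × ℂ^{n+1} be holomorphic with −i⟨v(z), conj v(z)⟩ > 0 for all z ∈ U, satisfying for all z ∈ U and all α, β the constraints ⟨v(z), ∂_α v(z)⟩ = 0 and ⟨∂_α v(z), ∂_β v(z)⟩ = 0. Fix z₀ ∈ U and set c_α := −⟨v(z₀), conj(∂_α v(z₀))⟩ / ⟨v(z₀), conj v(z₀)⟩. Let M be the (n+1)×(n+1) matrix with first column Z(z₀) and (1+α)-th column conj(∂_α Z(z₀)) + c_α · conj(Z(z₀)), and let N be the (n+1)×(n+1) matrix with first column F(z₀) and (1+α)-th column conj(∂_α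 F(z₀)) + c_α · conj(F(z₀)). If M is invertible, then the vector kinetic matrix 𝒩 := N · M⁻¹ is symmetric. -/
open Matrix
open scoped ComplexOrder

/-- If the columns of `M` stacked on `N` are pairwise symplectically orthogonal, then `N * M⁻¹` is
symmetric. -/
lemma Matrix.isSymm_mul_inv_of_transpose_mul_eq {m R : Type*} [Fintype m] [DecidableEq m]
    [CommRing R] {M N : Matrix m m R} (hM : IsUnit M) (h : Mᵀ * N = Nᵀ * M) :
    (N * M⁻¹).IsSymm := by
  have hdet : IsUnit M.det := (isUnit_iff_isUnit_det M).1 hM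
  have hdet' : IsUnit Mᵀ.det := by rwa [det_transpose]
  calc (N * M⁻¹)ᵀ = Mᵀ⁻¹ * Nᵀ * (M * M⁻¹) := by
        rw [mul_nonsing_inv M hdet, transpose_mul, transpose_nonsing_inv, Matrix.mul_one]
    _ = Mᵀ⁻¹ * (Nᵀ * M) * M⁻¹ := by simp only [Matrix.mul_assoc]
    _ = Mᵀ⁻¹ * Mᵀ * (N * M⁻¹) := by rw [← h]; simp only [Matrix.mul_assoc]
    _ = N * M⁻¹ := by rw [nonsing_inv_mul _ hdet', Matrix.one_mul]

/-- For a holomorphic section `v = (Z,F)` of local special Kähler geometry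
(with `−i⟨v, conj v⟩ > 0`, `⟨v, ∂_α v⟩ = 0`, `⟨∂_α v, ∂_β v⟩ = 0`), if at `z₀` the matrix
`M = (Z(z₀) | conj(∂_α Z(z₀)) + c_α conj(Z(z₀)))` is invertible, then the vector kinetic
matrix `𝒩 = N · M⁻¹`, with `N = (F(z₀) | conj(∂_α F(z₀)) + c_α conj(F(z₀)))` and
`c_α = −⟨v(z₀), conj(∂_α v(z₀))⟩ / ⟨v(z₀), conj v(z₀)⟩`, is symmetric. -/
theorem vector_kinetic_matrix_isSymm (n : ℕ) (hn : 1 ≤ n)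
    (U : Set (Fin n → ℂ)) (hU : IsOpen U)
    (Z F : (Fin n → ℂ) → (Fin (n + 1) → ℂ))
    (hZ : DifferentiableOn ℂ Z U) (hF : DifferentiableOn ℂ F U)
    (hpos : ∀ z ∈ U, 0 < -Complex.I *
      ∑ I : Fin (n + 1), (Z z I * starRingEnd ℂ (F z I) - F z I * starRingEnd ℂ (Z z I)))
    (hvdv : ∀ z ∈ U, ∀ α : Fin n,
      ∑ I : Fin (n + 1), (Z z I * fderiv ℂ F z (Pi.single α 1) I
        - F z I * fderiv ℂ Z z (Pi.single α 1) I) = 0)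
    (hdvdv : ∀ z ∈ U, ∀ α β : Fin n,
      ∑ I : Fin (n + 1), (fderiv ℂ Z z (Pi.single α 1) I * fderiv ℂ F z (Pi.single β 1) I
        - fderiv ℂ F z (Pi.single α 1) I * fderiv ℂ Z z (Pi.single β 1) I) = 0)
    (z₀ : Fin n → ℂ) (hz₀ : z₀ ∈ U)
    (c : Fin n → ℂ)
    (hc : ∀ α : Fin n, c α =
      -(∑ I : Fin (n + 1), (Z z₀ I * starRingEnd ℂ (fderiv ℂ F z₀ (Pi.single α 1) I)
          - F z₀ I * starRingEnd ℂ (fderiv ℂ Z z₀ (Pi.single α 1) I))) /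
        (∑ I : Fin (n + 1), (Z z₀ I * starRingEnd ℂ (F z₀ I)
          - F z₀ I * starRingEnd ℂ (Z z₀ I))))
    (M N : Matrix (Fin (n + 1)) (Fin (n + 1)) ℂ)
    (hM : M = Matrix.of fun I j => Fin.cases (Z z₀ I)
      (fun α : Fin n => starRingEnd ℂ (fderiv ℂ Z z₀ (Pi.single α 1) I)
        + c α * starRingEnd ℂ (Z z₀ I)) j)
    (hN : N = Matrix.of fun I j => Fin.cases (F z₀ I)
      (fun α : Fin n => starRingEnd ℂ (fderiv ℂ F z₀ (Pi.single α 1) I)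
        + c α * starRingEnd ℂ (F z₀ I)) j)
    (hMinv : IsUnit M) :
    (N * M⁻¹).IsSymm := by
  have hne : ∑ I : Fin (n + 1), (Z z₀ I * starRingEnd ℂ (F z₀ I)
      - F z₀ I * starRingEnd ℂ (Z z₀ I)) ≠ 0 :=
    right_ne_zero_of_mul (hpos z₀ hz₀).ne'
  have hcol (α : Fin n) : ∑ I : Fin (n + 1),
      (Z z₀ I * (starRingEnd ℂ (fderiv ℂ F z₀ (Pi.single α 1) I) + c α * starRingEnd ℂ (F z₀ I))
        - F z₀ I * (starRingEnd ℂ (fderiv ℂ Z z₀ (Pi.single α 1) I)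
          + c α * starRingEnd ℂ (Z z₀ I))) = 0 := by
    have h := hc α
    rw [eq_div_iff hne, eq_neg_iff_add_eq_zero, Finset.mul_sum, ← Finset.sum_add_distrib] at h
    rw [← h]
    exact Finset.sum_congr rfl fun I _ => by ring
  have hcols (α β : Fin n) : ∑ I : Fin (n + 1),
      ((starRingEnd ℂ (fderiv ℂ Z z₀ (Pi.single α 1) I) + c α * starRingEnd ℂ (Z z₀ I))
          * (starRingEnd ℂ (fderiv ℂ F z₀ (Pi.single β 1) I) + c β * starRingEnd ℂ (F z₀ I))
        - (starRingEnd ℂ (fderiv ℂ F z₀ (Pi.single α 1) I) + c α * starRingEnd ℂ (F z₀ I))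
          * (starRingEnd ℂ (fderiv ℂ Z z₀ (Pi.single β 1) I)
            + c β * starRingEnd ℂ (Z z₀ I))) = 0 := by
    have h₁ := congrArg (starRingEnd ℂ) (hdvdv z₀ hz₀ α β)
    have h₂ := congrArg (fun x => c α * starRingEnd ℂ x) (hvdv z₀ hz₀ β)
    have h₃ := congrArg (fun x => c β * starRingEnd ℂ x) (hvdv z₀ hz₀ α)
    simp only [map_sum, map_sub, map_mul, map_zero, mul_zero, Finset.mul_sum] at h₁ h₂ h₃
    have h := congrArg₂ (· - ·) (congrArg₂ (· + ·) h₁ h₂) h₃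
    simp only [← Finset.sum_add_distrib, ← Finset.sum_sub_distrib, add_zero, sub_zero] at h
    rw [← h]
    exact Finset.sum_congr rfl fun I _ => by ring
  refine Matrix.isSymm_mul_inv_of_transpose_mul_eq hMinv ?_
  ext i j
  simp only [Matrix.mul_apply, Matrix.transpose_apply]
  rw [← sub_eq_zero, ← Finset.sum_sub_distrib]
  subst hM hN
  cases i using Fin.cases with
  | zero =>
    cases j using Fin.cases with
    | zero => exact Finset.sum_eq_zero fun I _ => sub_eq_zero.2 (mul_comm _ _)
    | succ β => exact hcol β
  | succ α =>
    cases j using Fin.cases with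
    | zero =>
      rw [← neg_eq_zero, ← Finset.sum_neg_distrib, ← hcol α]
      refine Finset.sum_congr rfl fun I _ => ?_
      simp only [Matrix.of_apply, Fin.cases_zero, Fin.cases_succ]
      ring
    | succ β => exact hcols α β
end

section
/- Let n ≥ 1, let U ⊆ ℂⁿ be open, and let v = (Z, F) : U → ℂ^{n+1} × ℂ^{n+1} be holomorphic with −i⟨v(z), conj v(z)⟩ > 0 for all z ∈ U, satisfying for all z ∈ U and all α, β the constraints ⟨v(z), ∂_α v(z)⟩ = 0 and ⟨∂_α v(z), ∂_β v(z)⟩ = 0. Let z₀ ∈ U and suppose the Hermitian metric g(z₀), with entries g_{αβ̄} = ∂²K/∂z^α ∂z̄^β evaluated at z₀ for K := −log(−i⟨v, conj v⟩), is positive definite. Then there exists a symplectic matrix S ∈ Sp(2(n+1), ℝ) such that, writing S·v(z) = (Z̃(z), F̃(z)) (with v regarded as a column vector in ℂ^{2(n+1)}), the (n+1)×(n+1) matrix with columns Z̃(z₀), ∂_1 Z̃(z₀), …, ∂_n Z̃(z₀) is invertible; i.e. every holomorphic section of local special Kähler geometry can be brought, by a symplectic transformation, to a basis in which a prepotential exists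 near z₀. -/
open Matrix
open scoped ComplexOrder

/-- For a Lagrangian frame `(X, Y)` over a field, some diagonal shear `X + D * Y` is invertible. -/
theorem exists_diagonal_isUnit_add_mul {m 𝕜 : Type*} [Fintype m] [DecidableEq m] [Field 𝕜]
    (X Y : Matrix m m 𝕜) (hsymm : Xᵀ * Y = Yᵀ * X)
    (hinj : ∀ c, X *ᵥ c = 0 → Y *ᵥ c = 0 → c = 0) :
    ∃ d : m → ℕ, IsUnit (X + diagonal (fun i => (d i : 𝕜)) * Y) := by
  induction hr : Module.finrank 𝕜 (LinearMap.ker X.mulVecLin) using Nat.strong_induction_on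
    generalizing X with
  | _ r ih =>
  by_cases hX : ∀ c, X *ᵥ c = 0 → c = 0
  · refine ⟨0, ?_⟩
    have : IsUnit X := by
      rw [← Matrix.mulVec_injective_iff_isUnit]
      exact (injective_iff_map_eq_zero X.mulVecLin).2 hX
    simpa using this
  push Not at hX
  obtain ⟨c, hXc, hc⟩ := hX
  obtain ⟨i, hi⟩ := Function.ne_iff.1 fun h : Y *ᵥ c = 0 => hc (hinj c hXc h)
  have hE : ∀ d, (diagonal (Pi.single i (1 : 𝕜)) * Y) *ᵥ d = Pi.single i ((Y *ᵥ d) i) := by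
    intro d
    rw [← mulVec_mulVec]
    ext j
    rcases eq_or_ne j i with rfl | hj <;> simp [mulVec_diagonal, *]
  have hker : ∀ d, (X + diagonal (Pi.single i 1) * Y) *ᵥ d = 0 → X *ᵥ d = 0 ∧ (Y *ᵥ d) i = 0 := by
    intro d hd
    rw [add_mulVec, hE] at hd
    have horth : (Y *ᵥ c) ⬝ᵥ (X *ᵥ d) = 0 := by
      rw [dotProduct_mulVec, ← mulVec_transpose, mulVec_mulVec, hsymm, ← mulVec_mulVec, hXc]
      simp
    have hYd : (Y *ᵥ d) i = 0 := by
      have := congrArg (fun w => (Y *ᵥ c) ⬝ᵥ w) hd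
      simp only [dotProduct_add, horth, dotProduct_single, dotProduct_zero, zero_add] at this
      exact (mul_eq_zero.1 this).resolve_left hi
    exact ⟨by simpa [hYd] using hd, hYd⟩
  have hlt : LinearMap.ker (X + diagonal (Pi.single i 1) * Y).mulVecLin <
      LinearMap.ker X.mulVecLin := by
    refine lt_of_le_of_ne (fun d hd => (hker d hd).1) fun h => hi ?_
    have : c ∈ LinearMap.ker X.mulVecLin := hXc
    rw [← h] at this
    exact (hker c this).2
  obtain ⟨d, hd⟩ := ih _ (hr ▸ Submodule.finrank_lt_finrank_of_lt hlt)
    (X + diagonal (Pi.single i 1) * Y)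
    (by simp [Matrix.add_mul, Matrix.mul_add, transpose_mul, hsymm, Matrix.mul_assoc])
    (fun d hd hYd => hinj d (hker d hd).1 hYd) rfl
  refine ⟨Pi.single i 1 + d, ?_⟩
  convert hd using 1
  rw [add_assoc, ← Matrix.add_mul, diagonal_add]
  congr 3
  ext j
  rcases eq_or_ne j i with rfl | hj <;> simp [*]

/-- The real-linear map `s ↦ a * s + b * conj s`, with Wirtinger coefficients `a` and `b`. -/
noncomputable def wirtingerCLM (a b : ℂ) : ℂ →L[ℝ] ℂ :=
  a • ContinuousLinearMap.id ℝ ℂ + b • (Complex.conjCLE : ℂ →L[ℝ] ℂ)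

theorem wirtingerCLM_apply (a b s : ℂ) :
    wirtingerCLM a b s = a * s + b * starRingEnd ℂ s := by
  simp [wirtingerCLM]

/-- The Hermitian form `-i⟨(Z, F), conj (W, G)⟩`. -/
noncomputable def symplecticHerm {m : Type*} [Fintype m] (Z F W G : m → ℂ) : ℂ :=
  -Complex.I * ∑ i, (Z i * starRingEnd ℂ (G i) - F i * starRingEnd ℂ (W i))

theorem symplecticHerm_smul_left {m : Type*} [Fintype m] (a : ℂ) (Z F W G : m → ℂ) :
    symplecticHerm (a • Z) (a • F) W G = a * symplecticHerm Z F W G := by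
  simp only [symplecticHerm, Pi.smul_apply, smul_eq_mul, mul_assoc, ← mul_sub, ← Finset.mul_sum]
  ring

theorem symplecticHerm_smul_right {m : Type*} [Fintype m] (a : ℂ) (Z F W G : m → ℂ) :
    symplecticHerm Z F (a • W) (a • G) = starRingEnd ℂ a * symplecticHerm Z F W G := by
  simp only [symplecticHerm, Pi.smul_apply, smul_eq_mul, map_mul, Finset.mul_sum]
  exact Finset.sum_congr rfl fun i _ => by ring

theorem hasFDerivAt_symplecticHerm {m : Type*} [Fintype m] {Z F W G : ℂ → m → ℂ}
    {Z' F' W' G' : m → ℂ} {t : ℂ} (hZ : HasDerivAt Z Z' t) (hF : HasDerivAt F F' t)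
    (hW : HasDerivAt W W' t) (hG : HasDerivAt G G' t) :
    HasFDerivAt (𝕜 := ℝ) (fun s => symplecticHerm (Z s) (F s) (W s) (G s))
      (wirtingerCLM (symplecticHerm Z' F' (W t) (G t)) (symplecticHerm (Z t) (F t) W' G')) t := by
  have hol : ∀ {f : ℂ → m → ℂ} {f' : m → ℂ}, HasDerivAt f f' t → ∀ i,
      HasFDerivAt (𝕜 := ℝ) (fun s => f s i) (wirtingerCLM (f' i) 0) t := fun h i => by
    refine (((hasDerivAt_pi.1 h i).hasFDerivAt).restrictScalars ℝ).congr_fderiv ?_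
    ext s; simp [wirtingerCLM_apply, mul_comm]
  have anti : ∀ {f : ℂ → m → ℂ} {f' : m → ℂ}, HasDerivAt f f' t → ∀ i,
      HasFDerivAt (𝕜 := ℝ) (fun s => starRingEnd ℂ (f s i))
        (wirtingerCLM 0 (starRingEnd ℂ (f' i))) t := fun h i => by
    refine ((Complex.conjCLE : ℂ →L[ℝ] ℂ).hasFDerivAt.comp t (hol h i)).congr_fderiv ?_
    ext s; simp [wirtingerCLM_apply]
  have := (HasFDerivAt.fun_sum (u := Finset.univ) fun i _ =>
    ((hol hZ i).mul (anti hG i)).sub ((hol hF i).mul (anti hW i))).const_mul (-Complex.I)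
  refine this.congr_fderiv ?_
  ext s
  simp only [symplecticHerm, wirtingerCLM_apply, _root_.smul_apply, smul_eq_mul,
    _root_.sum_apply, _root_.sub_apply, _root_.add_apply]
  rw [mul_assoc, mul_assoc, ← mul_add, Finset.sum_mul, Finset.sum_mul, ← Finset.sum_add_distrib]
  congr 1
  exact Finset.sum_congr rfl fun i _ => by ring

theorem hasFDerivAt_neg_log {f : ℂ → ℂ} {a b t : ℂ}
    (hf : HasFDerivAt (𝕜 := ℝ) f (wirtingerCLM a b) t) (h0 : f t ∈ Complex.slitPlane) :
    HasFDerivAt (𝕜 := ℝ) (fun s => -Complex.log (f s))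
      (wirtingerCLM (-(a / f t)) (-(b / f t))) t := by
  have hlog := (Complex.hasStrictDerivAt_log h0).hasDerivAt.hasFDerivAt.restrictScalars ℝ
  refine (hlog.comp t hf).neg.congr_fderiv ?_
  ext s
  simp [wirtingerCLM_apply]
  ring

theorem hasFDerivAt_neg_div {f g : ℂ → ℂ} {a b a' b' t : ℂ}
    (hf : HasFDerivAt (𝕜 := ℝ) f (wirtingerCLM a b) t)
    (hg : HasFDerivAt (𝕜 := ℝ) g (wirtingerCLM a' b') t) (h0 : g t ≠ 0) :
    HasFDerivAt (𝕜 := ℝ) (fun s => -(f s / g s))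
      (wirtingerCLM (-((a * g t - f t * a') / g t ^ 2)) (-((b * g t - f t * b') / g t ^ 2))) t := by
  have hinv := (hasDerivAt_inv h0).hasFDerivAt.restrictScalars ℝ
  refine (hf.mul (hinv.comp t hg)).neg.congr_fderiv ?_
  ext s
  simp [wirtingerCLM_apply]
  field_simp
  ring

/-- If `(Z', F')` is proportional to `(Z, F)` at a point, then `∂∂̄ (-log (-i⟨v, conj v⟩))`
vanishes there. -/
theorem wirtinger_mixed_neg_log_symplecticHerm_eq_zero {m : Type*} [Fintype m]
    {V : Set ℂ} (hV : IsOpen V) {Z F : ℂ → m → ℂ} (hZ : DifferentiableOn ℂ Z V)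
    (hF : DifferentiableOn ℂ F V)
    (hpos : ∀ t ∈ V, 0 < symplecticHerm (Z t) (F t) (Z t) (F t))
    {t₀ : ℂ} (ht₀ : t₀ ∈ V) (a : ℂ) (hZ' : deriv Z t₀ = a • Z t₀) (hF' : deriv F t₀ = a • F t₀)
    {k q : ℂ → ℂ} (hk : ∀ t, k t = -Complex.log (symplecticHerm (Z t) (F t) (Z t) (F t)))
    (hq : ∀ t ∈ V, q t = (1 / 2 : ℂ) * (fderiv ℝ k t 1 + Complex.I * fderiv ℝ k t Complex.I)) :
    fderiv ℝ q t₀ 1 - Complex.I * fderiv ℝ q t₀ Complex.I = 0 := by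
  have hdZ : ∀ t ∈ V, HasDerivAt Z (deriv Z t) t := fun t ht =>
    (hZ.differentiableAt (hV.mem_nhds ht)).hasDerivAt
  have hdF : ∀ t ∈ V, HasDerivAt F (deriv F t) t := fun t ht =>
    (hF.differentiableAt (hV.mem_nhds ht)).hasDerivAt
  have hH := fun t ht =>
    hasFDerivAt_symplecticHerm (hdZ t ht) (hdF t ht) (hdZ t ht) (hdF t ht)
  have hqV : ∀ t ∈ V, q t = -(symplecticHerm (Z t) (F t) (deriv Z t) (deriv F t) /
      symplecticHerm (Z t) (F t) (Z t) (F t)) := fun t ht => by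
    have hslit : symplecticHerm (Z t) (F t) (Z t) (F t) ∈ Complex.slitPlane :=
      Or.inl (Complex.pos_iff.1 (hpos t ht)).1
    rw [hq t ht, funext hk, (hasFDerivAt_neg_log (hH t ht) hslit).fderiv,
      wirtingerCLM_apply, wirtingerCLM_apply, map_one, Complex.conj_I]
    linear_combination (-(symplecticHerm (deriv Z t) (deriv F t) (Z t) (F t) /
      symplecticHerm (Z t) (F t) (Z t) (F t)) + (symplecticHerm (Z t) (F t) (deriv Z t) (deriv F t) /
      symplecticHerm (Z t) (F t) (Z t) (F t))) / 2 * Complex.I_sq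
  have h0 := (hpos t₀ ht₀).ne'
  have hN := hasFDerivAt_symplecticHerm (hdZ t₀ ht₀) (hdF t₀ ht₀)
    ((hZ.deriv hV).differentiableAt (hV.mem_nhds ht₀)).hasDerivAt
    ((hF.deriv hV).differentiableAt (hV.mem_nhds ht₀)).hasDerivAt
  have hqd := (hasFDerivAt_neg_div hN (hH t₀ ht₀) h0).congr_of_eventuallyEq
    (Filter.eventually_of_mem (hV.mem_nhds ht₀) hqV)
  rw [hqd.fderiv, wirtingerCLM_apply, wirtingerCLM_apply, map_one, Complex.conj_I, hZ', hF']
  simp only [symplecticHerm_smul_left, symplecticHerm_smul_right]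
  ring_nf
  simp only [Complex.I_sq]
  ring

theorem wirtinger_sum {n : ℕ} (L : (Fin n → ℂ) →L[ℝ] ℂ) (c : Fin n → ℂ) :
    ∑ β, starRingEnd ℂ (c β) * (L (Pi.single β 1) + Complex.I * L (Pi.single β Complex.I)) =
      L c + Complex.I * L (Complex.I • c) ∧
    ∑ α, c α * (L (Pi.single α 1) - Complex.I * L (Pi.single α Complex.I)) =
      L c - Complex.I * L (Complex.I • c) := by
  have hs : ∀ β (w : ℂ), L (Pi.single β w) =
      w.re * L (Pi.single β 1) + w.im * L (Pi.single β Complex.I) := fun β w => by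
    rw [← Complex.real_smul, ← Complex.real_smul, ← map_smul, ← map_smul, ← map_add]
    congr 1
    rw [← Pi.single_smul', ← Pi.single_smul', ← Pi.single_add]
    congr 1
    simp
  have hL : ∀ w : Fin n → ℂ, L w = ∑ β, L (Pi.single β (w β)) := fun w => by
    rw [← map_sum, Finset.univ_sum_single]
  rw [hL c, hL (Complex.I • c), Finset.mul_sum, ← Finset.sum_add_distrib,
    ← Finset.sum_sub_distrib]
  refine ⟨Finset.sum_congr rfl fun β _ => ?_, Finset.sum_congr rfl fun β _ => ?_⟩ <;>
  · rw [hs β (c β), hs β ((Complex.I • c) β)]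
    conv_lhs => rw [← Complex.re_add_im (c β)]
    simp only [map_add, map_mul, Complex.conj_ofReal, Complex.conj_I, Pi.smul_apply, smul_eq_mul,
      Complex.I_mul_re, Complex.I_mul_im, Complex.ofReal_neg]
    linear_combination (-(c β).im * L (Pi.single β Complex.I)) * Complex.I_sq

/-- If the metric `∂∂̄K` is positive definite, no nonzero tangent vector `c` satisfies
`∂_c v = a • v`. -/
theorem tangent_eq_zero_of_posDef {n : ℕ} {m : Type*} [Fintype m] {U : Set (Fin n → ℂ)}
    (hU : IsOpen U) {Z F : (Fin n → ℂ) → m → ℂ}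
    (hZ : DifferentiableOn ℂ Z U) (hF : DifferentiableOn ℂ F U)
    (hpos : ∀ z ∈ U, 0 < symplecticHerm (Z z) (F z) (Z z) (F z))
    {z₀ : Fin n → ℂ} (hz₀ : z₀ ∈ U) {K : (Fin n → ℂ) → ℂ}
    (hK : ∀ z, K z = -Complex.log (symplecticHerm (Z z) (F z) (Z z) (F z)))
    (hg : Matrix.PosDef (Matrix.of fun α β : Fin n => wirtingerD (wirtingerDBar K β) α z₀))
    {a : ℂ} {c : Fin n → ℂ} (hZc : fderiv ℂ Z z₀ c = a • Z z₀)
    (hFc : fderiv ℂ F z₀ c = a • F z₀) : c = 0 := by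
  by_contra hc
  have hdZ : ∀ z ∈ U, DifferentiableAt ℂ Z z := fun z hz => hZ.differentiableAt (hU.mem_nhds hz)
  have hdF : ∀ z ∈ U, DifferentiableAt ℂ F z := fun z hz => hF.differentiableAt (hU.mem_nhds hz)
  have hdK : ∀ z ∈ U, DifferentiableAt ℝ K z := fun z hz => by
    have hZr := differentiableAt_pi.1 ((hdZ z hz).restrictScalars ℝ)
    have hFr := differentiableAt_pi.1 ((hdF z hz).restrictScalars ℝ)
    have hconj : ∀ {f : (Fin n → ℂ) → ℂ}, DifferentiableAt ℝ f z →
        DifferentiableAt ℝ (fun w => starRingEnd ℂ (f w)) z := fun hf => hf.star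
    have hlog := (Complex.hasStrictDerivAt_log (Or.inl (Complex.pos_iff.1 (hpos z hz)).1)).hasDerivAt
      |>.differentiableAt.restrictScalars ℝ
    rw [funext hK]
    refine (hlog.comp z (f := fun w => symplecticHerm (Z w) (F w) (Z w) (F w)) ?_).neg
    exact (DifferentiableAt.fun_sum fun i _ =>
      ((hZr i).mul (hconj (hFr i))).sub ((hFr i).mul (hconj (hZr i)))).const_mul _
  have hdD : ∀ β, DifferentiableAt ℝ (wirtingerDBar K β) z₀ := fun β => by
    by_contra h
    have := hg.diag_pos (i := β)
    simp [wirtingerD, fderiv_zero_of_not_differentiableAt h] at this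
  have hline : ∀ t : ℂ, HasDerivAt (fun s : ℂ => z₀ + s • c) c t := fun t => by
    simpa using ((hasDerivAt_id t).smul_const c).const_add z₀
  have hlineR : ∀ t : ℂ, HasFDerivAt (𝕜 := ℝ) (fun s : ℂ => z₀ + s • c)
      ((ContinuousLinearMap.toSpanSingleton ℂ c).restrictScalars ℝ) t := fun t =>
    (hline t).hasFDerivAt.restrictScalars ℝ
  have hcont : Continuous (fun s : ℂ => z₀ + s • c) := by fun_prop
  set V : Set ℂ := (fun s : ℂ => z₀ + s • c) ⁻¹' U with hVdef
  have h0V : (0 : ℂ) ∈ V := by simpa [hVdef] using hz₀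
  let q : ℂ → ℂ := fun t => ∑ β, starRingEnd ℂ (c β) * wirtingerDBar K β (z₀ + t • c)
  have hvanish := wirtinger_mixed_neg_log_symplecticHerm_eq_zero (q := q)
    (k := fun t => K (z₀ + t • c)) (hU.preimage hcont)
    (Z := fun t => Z (z₀ + t • c)) (F := fun t => F (z₀ + t • c))
    (fun t ht => ((hdZ _ ht).comp t (hline t).differentiableAt).differentiableWithinAt)
    (fun t ht => ((hdF _ ht).comp t (hline t).differentiableAt).differentiableWithinAt)
    (fun t ht => hpos _ ht) h0V a
    (by
      have := (hdZ _ h0V).hasFDerivAt.comp_hasDerivAt (0 : ℂ) (hline 0)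
      simpa [hZc, Function.comp_def] using this.deriv)
    (by
      have := (hdF _ h0V).hasFDerivAt.comp_hasDerivAt (0 : ℂ) (hline 0)
      simpa [hFc, Function.comp_def] using this.deriv)
    (fun t => hK _)
    (fun t ht => by
      have := (hdK _ ht).hasFDerivAt.comp t (hlineR t)
      have hk : fderiv ℝ (fun s : ℂ => K (z₀ + s • c)) t = _ := this.fderiv
      rw [hk]
      have hsum := (wirtinger_sum (fderiv ℝ K (z₀ + t • c)) c).1
      simp only [q, wirtingerDBar, ContinuousLinearMap.comp_apply,
        ContinuousLinearMap.coe_restrictScalars', ContinuousLinearMap.toSpanSingleton_apply,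
        one_smul]
      rw [← hsum, Finset.mul_sum]
      exact Finset.sum_congr rfl fun β _ => by ring)
  have hqd : HasFDerivAt (𝕜 := ℝ) q (∑ β, starRingEnd ℂ (c β) •
      (fderiv ℝ (wirtingerDBar K β) z₀).comp
        ((ContinuousLinearMap.toSpanSingleton ℂ c).restrictScalars ℝ)) 0 := by
    refine HasFDerivAt.fun_sum fun β _ => HasFDerivAt.const_mul ?_ _
    have h := (hdD β).hasFDerivAt
    exact HasFDerivAt.comp (0 : ℂ) (by simpa using h) (hlineR 0)
  have hquad : ∑ α, ∑ β, c α * (starRingEnd ℂ (c β) * wirtingerD (wirtingerDBar K β) α z₀) = 0 := by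
    rw [hqd.fderiv] at hvanish
    simp only [_root_.sum_apply, _root_.smul_apply, smul_eq_mul,
      ContinuousLinearMap.comp_apply, ContinuousLinearMap.coe_restrictScalars',
      ContinuousLinearMap.toSpanSingleton_apply, one_smul] at hvanish
    rw [Finset.mul_sum, ← Finset.sum_sub_distrib] at hvanish
    rw [Finset.sum_comm, ← mul_zero (1 / 2 : ℂ), ← hvanish, Finset.mul_sum]
    refine Finset.sum_congr rfl fun β _ => ?_
    have hsum := (wirtinger_sum (fderiv ℝ (wirtingerDBar K β) z₀) c).2
    rw [show ∀ x y w : ℂ, x * y - Complex.I * (x * w) = x * (y - Complex.I * w) from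
      fun x y w => by ring, ← hsum, Finset.mul_sum, Finset.mul_sum]
    exact Finset.sum_congr rfl fun α _ => by simp only [wirtingerD]; ring
  have hlt := hg.dotProduct_mulVec_pos (x := star c) (by simpa using hc)
  refine hlt.ne' ?_
  rw [← hquad]
  simp only [dotProduct, mulVec, star_star, Matrix.of_apply, Finset.mul_sum, Pi.star_apply]
  exact Finset.sum_congr rfl fun α _ => Finset.sum_congr rfl fun β _ => by
    rw [← starRingEnd_apply]; ring

/-- The matrix with columns `x, L e₁, …, L eₙ`. -/
noncomputable def frameMatrix {n : ℕ} {m : Type*} (x : m → ℂ) (L : (Fin n → ℂ) →L[ℂ] m → ℂ) :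
    Matrix m (Fin (n + 1)) ℂ :=
  Matrix.of fun I j => Fin.cases (x I) (fun α => L (Pi.single α 1) I) j

theorem frameMatrix_mulVec {n : ℕ} {m : Type*} (x : m → ℂ) (L : (Fin n → ℂ) →L[ℂ] m → ℂ)
    (c : Fin (n + 1) → ℂ) : frameMatrix x L *ᵥ c = c 0 • x + L (fun α => c α.succ) := by
  have hsingle : ∀ α, L (Pi.single α (c α.succ)) = c α.succ • L (Pi.single α 1) := fun α => by
    rw [← map_smul, ← Pi.single_smul', smul_eq_mul, mul_one]
  conv_rhs => rw [← Finset.univ_sum_single (fun α : Fin n => c α.succ), map_sum]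
  ext I
  simp [mulVec, dotProduct, Fin.sum_univ_succ, frameMatrix, hsingle, mul_comm]

/-- For a holomorphic section `v = (Z,F)` of local special Kähler geometry
(with `−i⟨v, conj v⟩ > 0`, `⟨v, ∂_α v⟩ = 0`, `⟨∂_α v, ∂_β v⟩ = 0`) whose metric
`g_{αβ̄} = ∂²K/∂z^α∂z̄^β` is positive definite at `z₀`, there is a symplectic matrix
`S = [[A,B],[C,D]] ∈ Sp(2(n+1),ℝ)` such that for the transformed section
`Z̃ = A·Z + B·F`, the matrix with columns `Z̃(z₀), ∂_1 Z̃(z₀), …, ∂_n Z̃(z₀)` is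
invertible (i.e. a prepotential exists in the transformed basis near `z₀`). -/
theorem exists_symplectic_prepotential_basis (n : ℕ) (hn : 1 ≤ n)
    (U : Set (Fin n → ℂ)) (hU : IsOpen U)
    (Z F : (Fin n → ℂ) → (Fin (n + 1) → ℂ))
    (hZ : DifferentiableOn ℂ Z U) (hF : DifferentiableOn ℂ F U)
    (hpos : ∀ z ∈ U, 0 < -Complex.I *
      ∑ I : Fin (n + 1), (Z z I * starRingEnd ℂ (F z I) - F z I * starRingEnd ℂ (Z z I)))
    (hvdv : ∀ z ∈ U, ∀ α : Fin n,
      ∑ I : Fin (n + 1), (Z z I * fderiv ℂ F z (Pi.single α 1) I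
        - F z I * fderiv ℂ Z z (Pi.single α 1) I) = 0)
    (hdvdv : ∀ z ∈ U, ∀ α β : Fin n,
      ∑ I : Fin (n + 1), (fderiv ℂ Z z (Pi.single α 1) I * fderiv ℂ F z (Pi.single β 1) I
        - fderiv ℂ F z (Pi.single α 1) I * fderiv ℂ Z z (Pi.single β 1) I) = 0)
    (z₀ : Fin n → ℂ) (hz₀ : z₀ ∈ U)
    (K : (Fin n → ℂ) → ℂ)
    (hK : ∀ z, K z = -Complex.log (-Complex.I *
      ∑ I : Fin (n + 1), (Z z I * starRingEnd ℂ (F z I) - F z I * starRingEnd ℂ (Z z I))))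
    (hg : Matrix.PosDef (Matrix.of fun α β : Fin n =>
      wirtingerD (wirtingerDBar K β) α z₀)) :
    ∃ A B C D : Matrix (Fin (n + 1)) (Fin (n + 1)) ℝ,
      (Matrix.fromBlocks A B C D)ᵀ *
          (Matrix.fromBlocks 0 1 (-1) 0 :
            Matrix (Fin (n + 1) ⊕ Fin (n + 1)) (Fin (n + 1) ⊕ Fin (n + 1)) ℝ) *
          Matrix.fromBlocks A B C D =
        (Matrix.fromBlocks 0 1 (-1) 0 :
          Matrix (Fin (n + 1) ⊕ Fin (n + 1)) (Fin (n + 1) ⊕ Fin (n + 1)) ℝ) ∧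
      IsUnit (Matrix.of fun I j => Fin.cases
        ((A.map Complex.ofReal *ᵥ Z z₀ + B.map Complex.ofReal *ᵥ F z₀) I)
        (fun α : Fin n => fderiv ℂ
          (fun z => A.map Complex.ofReal *ᵥ Z z + B.map Complex.ofReal *ᵥ F z) z₀
          (Pi.single α 1) I) j :
        Matrix (Fin (n + 1)) (Fin (n + 1)) ℂ) := by
  set dZ := fderiv ℂ Z z₀
  set dF := fderiv ℂ F z₀
  have hZ₀ : DifferentiableAt ℂ Z z₀ := hZ.differentiableAt (hU.mem_nhds hz₀)
  have hF₀ : DifferentiableAt ℂ F z₀ := hF.differentiableAt (hU.mem_nhds hz₀)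
  let X := frameMatrix (Z z₀) dZ
  let Y := frameMatrix (F z₀) dF
  have hsymm : Xᵀ * Y = Yᵀ * X := by
    ext i j
    simp only [Matrix.mul_apply, Matrix.transpose_apply]
    rw [← sub_eq_zero, ← Finset.sum_sub_distrib]
    refine Fin.cases ?_ (fun α => ?_) i <;> refine Fin.cases ?_ (fun β => ?_) j
    · exact Finset.sum_eq_zero fun I _ => by simp [X, Y, frameMatrix]; ring
    · exact hvdv z₀ hz₀ β
    · rw [← neg_eq_zero, ← Finset.sum_neg_distrib, ← hvdv z₀ hz₀ α]
      exact Finset.sum_congr rfl fun I _ => by simp [X, Y, frameMatrix, dZ, dF]; ring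
    · exact hdvdv z₀ hz₀ α β
  have hinj : ∀ c, X *ᵥ c = 0 → Y *ᵥ c = 0 → c = 0 := fun c hXc hYc => by
    rw [frameMatrix_mulVec] at hXc hYc
    have htail := tangent_eq_zero_of_posDef hU hZ hF hpos hz₀ hK hg (a := -c 0)
      (c := fun α => c α.succ)
      (by rw [neg_smul]; exact eq_neg_of_add_eq_zero_right hXc)
      (by rw [neg_smul]; exact eq_neg_of_add_eq_zero_right hYc)
    have h0 : c 0 = 0 := by
      by_contra h0
      rw [htail, map_zero, add_zero, smul_eq_zero_iff_right h0] at hXc hYc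
      have := hpos z₀ hz₀
      simp [hXc, hYc] at this
    ext j
    exact Fin.cases h0 (fun α => congrFun htail α) j
  obtain ⟨d, hd⟩ := exists_diagonal_isUnit_add_mul X Y hsymm hinj
  refine ⟨1, diagonal fun i => (d i : ℝ), 0, 1, ?_, ?_⟩
  · simp [fromBlocks_transpose, fromBlocks_multiply]
  · convert hd using 1
    have hB : (diagonal fun i => (d i : ℝ)).map Complex.ofReal = diagonal fun i => (d i : ℂ) := by
      simp [diagonal_map]
    have h1 : (1 : Matrix (Fin (n + 1)) (Fin (n + 1)) ℝ).map Complex.ofReal = 1 := by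
      simp
    rw [h1, hB]
    have hder : HasFDerivAt (fun z => (1 : Matrix (Fin (n + 1)) (Fin (n + 1)) ℂ) *ᵥ Z z +
        diagonal (fun i => (d i : ℂ)) *ᵥ F z)
        (dZ + (LinearMap.toContinuousLinearMap
          (diagonal (fun i => (d i : ℂ))).mulVecLin).comp dF) z₀ := by
      simp only [one_mulVec]
      exact hZ₀.hasFDerivAt.add ((LinearMap.toContinuousLinearMap
        (diagonal (fun i => (d i : ℂ))).mulVecLin).hasFDerivAt.comp z₀ hF₀.hasFDerivAt)
    rw [hder.fderiv]
    ext I j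
    refine Fin.cases ?_ (fun α => ?_) j <;> simp [X, Y, frameMatrix, diagonal_mul, mulVec_diagonal]
end
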